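/- Let K be a number field and χ a character on the ideals of O_K (valued in {0,±1}, multiplicative, supported on ideals coprime to a fixed modulus) that is not principal, i.e., ψ is nontrivial on ideals coprime to the modulus. Then the Dirichlet series L(s,ψ) = Σ_𝒜 ψ(𝒜)N(𝒜)^{-s}, absolutely convergent for Re(s) > 1, extends to a holomorphic function on Re(s) > 1/2 up to the boundary of convergence... specifically: if ψ is a nontrivial Hecke character of trivial infinite type, then L(s,ψ) is entire. -/

import Mathlib

open NumberField

section

open Module

open scoped ContDiff

theorem norm_sub_le_of_periodic_of_hasDerivAt {g g' : ℝ → ℂ} {M : ℝ}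
    (hg : ∀ t, HasDerivAt g (g' t) t) (hper : Function.Periodic g 1)
    (hM : ∀ t, ‖g' t‖ ≤ M) (a b : ℝ) : ‖g a - g b‖ ≤ M := by
  have hM0 : 0 ≤ M := (norm_nonneg _).trans (hM 0)
  have h1 : g b = g (b + ⌊a - b⌋) := by
    have := hper.int_mul ⌊a - b⌋ b
    simpa using this.symm
  rw [h1]
  have h2 := (convex_univ : Convex ℝ (Set.univ : Set ℝ)).norm_image_sub_le_of_norm_hasDerivWithin_le
    (fun t _ => (hg t).hasDerivWithinAt) (fun t _ => hM t) (Set.mem_univ (b + ⌊a - b⌋))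
    (Set.mem_univ a)
  refine h2.trans (mul_le_of_le_one_right hM0 ?_)
  rw [Real.norm_eq_abs, abs_le]
  constructor <;> linarith [Int.floor_le (a - b), Int.lt_floor_add_one (a - b)]

theorem norm_sub_le_of_periodic_of_iterated_hasDerivAt (N : ℕ) {g : ℕ → ℝ → ℂ} {M : ℝ}
    (hg : ∀ j t, HasDerivAt (g j) (g (j + 1) t) t) (hper : ∀ j, Function.Periodic (g j) 1)
    (hM : ∀ t, ‖g (N + 1) t‖ ≤ M) (a b : ℝ) : ‖g 0 a - g 0 b‖ ≤ M := by
  induction N generalizing g a b with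
  | zero => exact norm_sub_le_of_periodic_of_hasDerivAt (hg 0) (hper 0) hM a b
  | succ N ih =>
    refine norm_sub_le_of_periodic_of_hasDerivAt (hg 0) (hper 0) (fun t => ?_) a b
    have hosc := ih (g := fun j => g (j + 1)) (fun j t => hg (j + 1) t)
      (fun j => hper (j + 1)) hM t
    have hcont : Continuous (g 1) :=
      continuous_iff_continuousAt.2 fun t => (hg 1 t).continuousAt
    have hint : ∫ x in (0 : ℝ)..1, g 1 x = 0 := by
      rw [intervalIntegral.integral_eq_sub_of_hasDerivAt (fun x _ => hg 0 x)
        (hcont.intervalIntegrable _ _)]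
      simpa using sub_eq_zero.2 (hper 0 0)
    have hmean : ∫ x in (0 : ℝ)..1, (g 1 t - g 1 x) = g 1 t := by
      rw [intervalIntegral.integral_sub intervalIntegrable_const
        (hcont.intervalIntegrable _ _), hint]
      simp
    have := intervalIntegral.norm_integral_le_of_norm_le_const
      (a := (0 : ℝ)) (b := 1) (f := fun x => g 1 t - g 1 x) (C := M) (fun x _ => hosc x)
    rw [hmean] at this
    simpa using this

section LatticeSum

variable {E : Type*} [NormedAddCommGroup E] [NormedSpace ℝ E]
  {ι : Type*} [Fintype ι] (b : Basis ι ℝ E)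

theorem exists_card_lattice_le [FiniteDimensional ℝ E] (R : ℝ) :
    ∃ C : ℝ, ∀ u : ℝ, 0 < u → u ≤ 1 → ∀ a : E,
      ∃ F : Finset (Submodule.span ℤ (Set.range b)),
        (F.card : ℝ) * u ^ Fintype.card ι ≤ C ∧ ∀ x, x ∉ F → R < ‖u • (a + (x : E))‖ := by
  classical
  obtain ⟨A, hA0, hA⟩ : ∃ A : ℝ, 0 < A ∧ ∀ i, ∀ y : E, |b.repr y i| ≤ A * ‖y‖ := by
    have : ∀ i, ∃ A : ℝ, 0 < A ∧ ∀ y : E, |b.repr y i| ≤ A * ‖y‖ := fun i => by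
      obtain ⟨A, hA, h⟩ := (LinearMap.toContinuousLinearMap (b.coord i)).isBoundedLinearMap.bound
      exact ⟨A, hA, fun y => by simpa using h y⟩
    choose A hA0 hA using this
    refine ⟨∑ i, A i + 1, add_pos_of_nonneg_of_pos (Finset.sum_nonneg fun i _ => (hA0 i).le) one_pos,
      fun i y => (hA i y).trans ?_⟩
    gcongr
    have := Finset.single_le_sum (f := A) (fun i _ => (hA0 i).le) (Finset.mem_univ i)
    linarith
  set R' := max R 0
  refine ⟨(2 * A * R' + 1) ^ Fintype.card ι, fun u hu hu1 a => ?_⟩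
  let e := (b.restrictScalars ℤ).equivFun
  let B : Finset (ι → ℤ) := Fintype.piFinset fun i =>
    Finset.Icc ⌈-(b.repr a i) - A * R' / u⌉ ⌊-(b.repr a i) + A * R' / u⌋
  refine ⟨B.map e.symm.toEquiv.toEmbedding, ?_, fun x hx => ?_⟩
  · rw [Finset.card_map, Fintype.card_piFinset]
    push_cast
    rw [← Finset.card_univ, ← Finset.prod_const, ← Finset.prod_const, ← Finset.prod_mul_distrib]
    refine Finset.prod_le_prod (fun i _ => by positivity) fun i _ => ?_
    rw [Int.card_Icc]
    have h0 : 0 ≤ A * R' / u := by positivity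
    have hle : ((⌊-(b.repr a i) + A * R' / u⌋ + 1 - ⌈-(b.repr a i) - A * R' / u⌉).toNat : ℝ)
        ≤ 2 * (A * R' / u) + 1 := by
      rw [← Int.cast_natCast, Int.toNat_eq_max]
      push_cast
      refine max_le ?_ (by positivity)
      linarith [Int.floor_le (-(b.repr a i) + A * R' / u), Int.le_ceil (-(b.repr a i) - A * R' / u)]
    calc _ ≤ (2 * (A * R' / u) + 1) * u := by gcongr
      _ = 2 * A * R' + u := by field_simp
      _ ≤ _ := by linarith
  · by_contra! h
    apply hx
    rw [Finset.mem_map]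
    refine ⟨e x, ?_, by simp⟩
    rw [Fintype.mem_piFinset]
    intro i
    have h1 : |b.repr (a + (x : E)) i| ≤ A * R' / u := by
      refine (hA i _).trans ?_
      rw [mul_div_assoc]
      gcongr
      rw [le_div_iff₀ hu]
      rw [norm_smul, Real.norm_of_nonneg hu.le] at h
      have := le_max_left R 0
      linarith
    have h2 : b.repr (x : E) i = (e x i : ℝ) := by
      simpa [e] using (b.restrictScalars_repr_apply ℤ x i).symm
    rw [map_add, Finsupp.add_apply, h2, abs_le] at h1
    rw [Finset.mem_Icc, Int.ceil_le, Int.le_floor]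
    constructor <;> linarith

variable {P : Type*} [NormedAddCommGroup P] [NormedSpace ℝ P]

/-- The partial derivative of a function on `P × E` along a direction of the second factor. -/
noncomputable def sndDeriv (v : E) (Φ : P × E → ℂ) : P × E → ℂ := fun p => fderiv ℝ Φ p (0, v)

theorem contDiff_sndDeriv {v : E} {Φ : P × E → ℂ} (hΦ : ContDiff ℝ ∞ Φ) :
    ContDiff ℝ ∞ (sndDeriv v Φ) :=
  (hΦ.fderiv_right (m := ∞) (by simp)).clm_apply contDiff_const

theorem sndDeriv_eq_zero {v : E} {Φ : P × E → ℂ} {R : ℝ}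
    (h0 : ∀ s x, R < ‖x‖ → Φ (s, x) = 0) (s : P) (x : E) (hx : R < ‖x‖) :
    sndDeriv v Φ (s, x) = 0 := by
  have : Φ =ᶠ[nhds (s, x)] fun _ => 0 := by
    filter_upwards [(isOpen_lt continuous_const continuous_snd.norm).mem_nhds
      (show (s, x) ∈ {p : P × E | R < ‖p.2‖} from hx)] with p hp
    exact h0 p.1 p.2 hp
  rw [sndDeriv, this.fderiv_eq]
  simp

/-- The sum over a translated and scaled lattice of the slice of a function at `s`. -/
noncomputable def latticeSum (Φ : P × E → ℂ) (s : P) (u : ℝ) (a : E) : ℂ :=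
  ∑' x : Submodule.span ℤ (Set.range b), Φ (s, u • (a + (x : E)))

omit [Fintype ι] [NormedAddCommGroup P] [NormedSpace ℝ P] in
theorem latticeSum_add_mem (Φ : P × E → ℂ) (s : P) (u : ℝ) (a : E)
    (v : Submodule.span ℤ (Set.range b)) :
    latticeSum b Φ s u (a + v) = latticeSum b Φ s u a := by
  rw [latticeSum, latticeSum, ← (Equiv.addLeft v).tsum_eq (fun x => Φ (s, u • (a + (x : E))))]
  simp [add_assoc]

omit [NormedAddCommGroup P] [NormedSpace ℝ P] in
theorem exists_finset_latticeSum_eq [FiniteDimensional ℝ E] {Φ : P × E → ℂ} {R : ℝ}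
    (h0 : ∀ s x, R < ‖x‖ → Φ (s, x) = 0) {u : ℝ} (hu : 0 < u) (R' : ℝ) :
    ∃ F : Finset (Submodule.span ℤ (Set.range b)), ∀ s a, ‖a‖ ≤ R' →
      (∀ x ∉ F, Φ (s, u • (a + (x : E))) = 0) ∧
      latticeSum b Φ s u a = ∑ x ∈ F, Φ (s, u • (a + (x : E))) := by
  obtain ⟨C, hC⟩ := exists_card_lattice_le b (R / u + R')
  obtain ⟨F, -, hF⟩ := hC 1 one_pos le_rfl 0
  have key : ∀ s a, ‖a‖ ≤ R' → ∀ x ∉ F, Φ (s, u • (a + (x : E))) = 0 := by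
    intro s a ha x hx
    apply h0
    have h1 := hF x hx
    rw [one_smul, zero_add] at h1
    rw [norm_smul, Real.norm_of_nonneg hu.le, ← div_lt_iff₀' hu]
    have := norm_sub_le (a + (x : E)) a
    rw [add_sub_cancel_left] at this
    linarith
  exact ⟨F, fun s a ha => ⟨key s a ha, tsum_eq_sum (key s a ha)⟩⟩

theorem hasDerivAt_latticeSum [FiniteDimensional ℝ E] {Φ : P × E → ℂ} {R : ℝ}
    (hΦ : ContDiff ℝ ∞ Φ) (h0 : ∀ s x, R < ‖x‖ → Φ (s, x) = 0) {u : ℝ} (hu : 0 < u)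
    (s : P) (a v : E) (t : ℝ) :
    HasDerivAt (fun t : ℝ => latticeSum b Φ s u (a + t • v))
      (u * latticeSum b (sndDeriv v Φ) s u (a + t • v)) t := by
  classical
  obtain ⟨F, hF⟩ := exists_finset_latticeSum_eq b h0 hu (‖a + t • v‖ + 1)
  obtain ⟨F', hF'⟩ := exists_finset_latticeSum_eq b (sndDeriv_eq_zero (v := v) h0) hu
    (‖a + t • v‖ + 1)
  have hsum : ∀ t' : ℝ, ‖a + t' • v‖ ≤ ‖a + t • v‖ + 1 → latticeSum b Φ s u (a + t' • v) =
      ∑ x ∈ F ∪ F', Φ (s, u • (a + t' • v + (x : E))) := fun t' ht' => by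
    rw [(hF s _ ht').2]
    exact Finset.sum_subset Finset.subset_union_left fun x _ hx => (hF s _ ht').1 x hx
  have hsum' : latticeSum b (sndDeriv v Φ) s u (a + t • v) =
      ∑ x ∈ F ∪ F', sndDeriv v Φ (s, u • (a + t • v + (x : E))) := by
    rw [(hF' s _ (by linarith)).2]
    exact Finset.sum_subset Finset.subset_union_right
      fun x _ hx => (hF' s _ (by linarith)).1 x hx
  have hev : (fun t : ℝ => latticeSum b Φ s u (a + t • v)) =ᶠ[nhds t]
      fun t' => ∑ x ∈ F ∪ F', Φ (s, u • (a + t' • v + (x : E))) := by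
    have hc : Continuous fun t' : ℝ => ‖a + t' • v‖ := by fun_prop
    filter_upwards [hc.continuousAt.eventually_lt_const (lt_add_one ‖a + t • v‖)] with t' ht'
    exact hsum t' ht'.le
  refine HasDerivAt.congr_of_eventuallyEq ?_ hev
  rw [hsum', Finset.mul_sum]
  refine HasDerivAt.fun_sum fun x _ => ?_
  have hd : HasDerivAt (fun t' : ℝ => (s, u • (a + t' • v + (x : E)))) ((0 : P), u • v) t := by
    refine (hasDerivAt_const t s).prodMk ?_
    have := ((((hasDerivAt_id' t).smul_const v).const_add a).add_const (x : E)).fun_const_smul u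
    simpa only [one_smul] using this
  have hfd := (hΦ.differentiable (by simp)
    (s, u • (a + t • v + (x : E)))).hasFDerivAt.comp_hasDerivAt t hd
  have hval : (u : ℂ) * sndDeriv v Φ (s, u • (a + t • v + (x : E))) =
      fderiv ℝ Φ (s, u • (a + t • v + (x : E))) (0, u • v) := by
    rw [show ((0 : P), u • v) = u • ((0 : P), v) by simp, map_smul, Complex.real_smul, sndDeriv]
  rw [hval]
  exact hfd

omit [Fintype ι] in
theorem contDiff_iterate_sndDeriv {v : E} {Φ : P × E → ℂ} (hΦ : ContDiff ℝ ∞ Φ) (j : ℕ) :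
    ContDiff ℝ ∞ ((sndDeriv v)^[j] Φ) := by
  induction j with
  | zero => exact hΦ
  | succ j ih => rw [Function.iterate_succ_apply']; exact contDiff_sndDeriv ih

theorem iterate_sndDeriv_eq_zero {v : E} {Φ : P × E → ℂ} {R : ℝ}
    (h0 : ∀ s x, R < ‖x‖ → Φ (s, x) = 0) (j : ℕ) (s : P) (x : E) (hx : R < ‖x‖) :
    (sndDeriv v)^[j] Φ (s, x) = 0 := by
  induction j generalizing s x with
  | zero => exact h0 s x hx
  | succ j ih =>
    rw [Function.iterate_succ_apply']
    exact sndDeriv_eq_zero ih s x hx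

omit [NormedSpace ℝ P] in
theorem exists_norm_latticeSum_le [FiniteDimensional ℝ E] [ProperSpace P] {Φ : P × E → ℂ} {R : ℝ}
    (hΦ : Continuous Φ) (h0 : ∀ s x, R < ‖x‖ → Φ (s, x) = 0) (S : ℝ) :
    ∃ C : ℝ, 0 ≤ C ∧ ∀ s, ‖s‖ ≤ S → ∀ u : ℝ, 0 < u → u ≤ 1 → ∀ a,
      ‖latticeSum b Φ s u a‖ * u ^ Fintype.card ι ≤ C := by
  have : ProperSpace E := FiniteDimensional.proper_real E
  obtain ⟨C, hC⟩ := exists_card_lattice_le b R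
  obtain ⟨M, hM⟩ := ((isCompact_closedBall (0 : P) S).prod
    (isCompact_closedBall (0 : E) R)).exists_bound_of_continuousOn hΦ.continuousOn
  have hM' : ∀ s, ‖s‖ ≤ S → ∀ x, ‖Φ (s, x)‖ ≤ max M 0 := fun s hs x => by
    by_cases hx : R < ‖x‖
    · simp [h0 s x hx]
    · exact (hM (s, x) ⟨by simpa using hs, by simpa using hx⟩).trans (le_max_left _ _)
  refine ⟨max C 0 * max M 0, by positivity, fun s hs u hu hu1 a => ?_⟩
  obtain ⟨F, hF, hF'⟩ := hC u hu hu1 a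
  rw [latticeSum, tsum_eq_sum (s := F) fun x hx => h0 _ _ (hF' x hx)]
  have h1 : ‖∑ x ∈ F, Φ (s, u • (a + (x : E)))‖ ≤ F.card * max M 0 := by
    refine (norm_sum_le _ _).trans ?_
    rw [← nsmul_eq_mul]
    exact Finset.sum_le_card_nsmul _ _ _ fun x _ => hM' s hs _
  calc _ ≤ F.card * max M 0 * u ^ Fintype.card ι := by gcongr
    _ = (F.card * u ^ Fintype.card ι) * max M 0 := by ring
    _ ≤ _ := by gcongr; exact hF.trans (le_max_left _ _)

theorem exists_norm_latticeSum_sub_le [FiniteDimensional ℝ E] [ProperSpace P] {Φ : P × E → ℂ}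
    {R : ℝ} (hΦ : ContDiff ℝ ∞ Φ) (h0 : ∀ s x, R < ‖x‖ → Φ (s, x) = 0) (S : ℝ) (N : ℕ) :
    ∃ C : ℝ, 0 ≤ C ∧ ∀ s, ‖s‖ ≤ S → ∀ u : ℝ, 0 < u → u ≤ 1 → ∀ a a',
      ‖latticeSum b Φ s u a - latticeSum b Φ s u a'‖ ≤ C * u ^ N := by
  classical
  have h1 : ∀ i, ∃ C : ℝ, 0 ≤ C ∧ ∀ s, ‖s‖ ≤ S → ∀ u : ℝ, 0 < u → u ≤ 1 → ∀ a, ∀ t : ℝ,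
      ‖latticeSum b Φ s u (a + t • b i) - latticeSum b Φ s u a‖ ≤ C * u ^ N := fun i => by
    set J := N + Fintype.card ι
    obtain ⟨C, hC0, hC⟩ := exists_norm_latticeSum_le b
      (contDiff_iterate_sndDeriv (v := b i) hΦ (J + 1)).continuous
      (iterate_sndDeriv_eq_zero h0 (J + 1)) S
    refine ⟨C, hC0, fun s hs u hu hu1 a t => ?_⟩
    have := norm_sub_le_of_periodic_of_iterated_hasDerivAt J (M := C * u ^ N)
      (g := fun j t => u ^ j * latticeSum b ((sndDeriv (b i))^[j] Φ) s u (a + t • b i))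
      (fun j t => ?_) (fun j t => ?_) (fun t => ?_) t 0
    · simpa using this
    · have := (hasDerivAt_latticeSum b (contDiff_iterate_sndDeriv (v := b i) hΦ j)
        (iterate_sndDeriv_eq_zero h0 j) hu s a (b i) t).const_mul ((u : ℂ) ^ j)
      rw [← mul_assoc, ← pow_succ] at this
      rw [Function.iterate_succ_apply']
      exact this
    · have := latticeSum_add_mem b ((sndDeriv (b i))^[j] Φ) s u (a + t • b i)
        ⟨b i, Submodule.subset_span ⟨i, rfl⟩⟩
      simp only [add_smul, one_smul, ← add_assoc, this]
    · rw [norm_mul, norm_pow, Complex.norm_real, Real.norm_of_nonneg hu.le]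
      calc _ = (u ^ (N + 1)) * (‖latticeSum b ((sndDeriv (b i))^[J + 1] Φ) s u (a + t • b i)‖ *
              u ^ Fintype.card ι) := by simp only [J]; ring
        _ ≤ u ^ N * C := by
          refine mul_le_mul (pow_le_pow_of_le_one hu.le hu1 (by simp)) (hC s hs u hu hu1 _)
            (by positivity) (by positivity)
        _ = _ := mul_comm _ _
  choose C hC0 hC using h1
  refine ⟨∑ i, C i, Finset.sum_nonneg fun i _ => hC0 i, fun s hs u hu hu1 a a' => ?_⟩
  have h2 : ∀ (c : ι → ℝ) (T : Finset ι), ‖latticeSum b Φ s u (a' + ∑ i ∈ T, c i • b i) -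
      latticeSum b Φ s u a'‖ ≤ (∑ i ∈ T, C i) * u ^ N := fun c T => by
    induction T using Finset.induction_on with
    | empty => simp
    | insert i T hi ih =>
      rw [Finset.sum_insert hi, Finset.sum_insert hi, add_comm (c i • b i), ← add_assoc, add_mul]
      refine (norm_sub_le_norm_sub_add_norm_sub _
        (latticeSum b Φ s u (a' + ∑ i ∈ T, c i • b i)) _).trans ?_
      exact add_le_add (hC i s hs u hu hu1 _ _) ih
  have := h2 (b.repr (a - a')) Finset.univ
  rwa [b.sum_repr, add_sub_cancel] at this

open MeasureTheory in
/-- A smooth compactly supported function summed over a translated lattice scaled by `u` agrees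
with its integral up to an error that decays faster than any power of `u`, locally uniformly
in parameters. -/
theorem exists_norm_latticeSum_sub_integral_le [MeasurableSpace E] [BorelSpace E]
    [FiniteDimensional ℝ E] [ProperSpace P] (μ : Measure E) [μ.IsAddHaarMeasure] {Φ : P × E → ℂ}
    {R : ℝ} (hΦ : ContDiff ℝ ∞ Φ) (h0 : ∀ s x, R < ‖x‖ → Φ (s, x) = 0) (S : ℝ) (N : ℕ) :
    ∃ C : ℝ, 0 ≤ C ∧ ∀ s, ‖s‖ ≤ S → ∀ u : ℝ, 0 < u → u ≤ 1 → ∀ a,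
      ‖latticeSum b Φ s u a - ((u ^ finrank ℝ E * μ.real (ZSpan.fundamentalDomain b))⁻¹ : ℝ) *
        ∫ x, Φ (s, x) ∂μ‖ ≤ C * u ^ N := by
  classical
  have : ProperSpace E := FiniteDimensional.proper_real E
  obtain ⟨C, hC0, hC⟩ := exists_norm_latticeSum_sub_le b hΦ h0 S N
  refine ⟨C, hC0, fun s hs u hu hu1 a => ?_⟩
  set D := ZSpan.fundamentalDomain b
  have hDm : MeasurableSet D := ZSpan.fundamentalDomain_measurableSet b
  have hDb : Bornology.IsBounded D := ZSpan.fundamentalDomain_isBounded b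
  have hD : IsAddFundamentalDomain (Submodule.span ℤ (Set.range b)) D μ :=
    ZSpan.isAddFundamentalDomain b μ
  have : VAddInvariantMeasure (Submodule.span ℤ (Set.range b)) E μ :=
    ⟨fun c s _ => measure_preimage_add μ (c : E) s⟩
  have hDfin : μ D ≠ ⊤ := hDb.measure_lt_top.ne
  have hD0 : μ.real D ≠ 0 := by
    rw [Measure.real, ENNReal.toReal_ne_zero]
    exact ⟨ZSpan.measure_fundamentalDomain_ne_zero b, hDfin⟩
  have hcs : Continuous fun x => Φ (s, x) := hΦ.continuous.comp (by fun_prop)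
  have hcu : Continuous fun x => Φ (s, u • x) := hΦ.continuous.comp (by fun_prop)
  have hcomp : HasCompactSupport fun x => Φ (s, u • x) := by
    refine HasCompactSupport.intro (isCompact_closedBall (0 : E) (R / u)) fun x hx => h0 _ _ ?_
    rw [norm_smul, Real.norm_of_nonneg hu.le, ← div_lt_iff₀' hu]
    simpa using hx
  have hint : Integrable (fun x => Φ (s, u • x)) μ := hcu.integrable_of_hasCompactSupport hcomp
  obtain ⟨R', hR'⟩ := hDb.exists_norm_le
  obtain ⟨F, hF⟩ := exists_finset_latticeSum_eq b h0 hu R'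
  have hterm : ∀ x : E, IntegrableOn (fun y => Φ (s, u • (y + x))) D μ := fun x =>
    (hint.comp_add_right x).integrableOn
  have hsumint : IntegrableOn (fun y => ∑ x ∈ F, Φ (s, u • (y + (x : E)))) D μ :=
    integrable_finsetSum _ fun x _ => hterm x
  have hLSint : IntegrableOn (fun y => latticeSum b Φ s u y) D μ :=
    hsumint.congr_fun (fun y hy => ((hF s y (hR' y hy)).2).symm) hDm
  have hmain : ∫ y in D, latticeSum b Φ s u y ∂μ =
      ((u ^ finrank ℝ E)⁻¹ : ℝ) * ∫ x, Φ (s, x) ∂μ := by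
    have h1 := Measure.integral_comp_smul μ (fun x => Φ (s, x)) u
    rw [abs_of_nonneg (by positivity), Complex.real_smul] at h1
    rw [← h1, hD.integral_eq_tsum'' _ hint, tsum_eq_sum (s := F),
      setIntegral_congr_fun hDm fun y hy => (hF s y (hR' y hy)).2,
      integral_finsetSum _ fun (x : Submodule.span ℤ (Set.range b)) _ => hterm x]
    · refine Finset.sum_congr rfl fun x _ => ?_
      simp [Submodule.vadd_def, add_comm]
    · intro x hx
      rw [setIntegral_congr_fun hDm fun y hy => ?_, integral_zero]
      have := (hF s y (hR' y hy)).1 x hx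
      simpa [Submodule.vadd_def, add_comm] using this
  have h2 : ∫ y in D, (latticeSum b Φ s u a - latticeSum b Φ s u y) ∂μ =
      μ.real D * latticeSum b Φ s u a - ((u ^ finrank ℝ E)⁻¹ : ℝ) * ∫ x, Φ (s, x) ∂μ := by
    have hconst : IntegrableOn (fun _ => latticeSum b Φ s u a) D μ :=
      integrableOn_const hDfin (by simp)
    rw [integral_sub hconst hLSint, hmain, setIntegral_const,
      Complex.real_smul]
  have h3 := norm_setIntegral_le_of_norm_le_const (f := fun y =>
    latticeSum b Φ s u a - latticeSum b Φ s u y) hDfin.lt_top (fun y _ => hC s hs u hu hu1 a y)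
  rw [h2] at h3
  have hD0' : (μ.real D : ℂ) ≠ 0 := by exact_mod_cast hD0
  have h4 : latticeSum b Φ s u a - ((u ^ finrank ℝ E * μ.real D)⁻¹ : ℝ) * ∫ x, Φ (s, x) ∂μ =
      (μ.real D : ℂ)⁻¹ * (μ.real D * latticeSum b Φ s u a -
        ((u ^ finrank ℝ E)⁻¹ : ℝ) * ∫ x, Φ (s, x) ∂μ) := by
    push_cast
    field_simp
  rw [h4, norm_mul, norm_inv, Complex.norm_real, Real.norm_of_nonneg measureReal_nonneg]
  rw [inv_mul_le_iff₀ (lt_of_le_of_ne measureReal_nonneg hD0.symm)]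
  exact h3.trans_eq (mul_comm _ _)

end LatticeSum

section Bump

/-- A smooth bump function on the line whose integer translates sum to one. -/
noncomputable def smoothStepDiff (t : ℝ) : ℝ :=
  Real.smoothTransition (t + 1) - Real.smoothTransition t

theorem contDiff_smoothStepDiff : ContDiff ℝ ∞ smoothStepDiff :=
  (Real.smoothTransition.contDiff.comp (contDiff_id.add contDiff_const)).sub
    Real.smoothTransition.contDiff

theorem smoothStepDiff_nonneg (t : ℝ) : 0 ≤ smoothStepDiff t :=
  sub_nonneg.2 (Real.smoothTransition.monotone (by linarith))

theorem abs_le_one_of_smoothStepDiff_ne_zero {t : ℝ} (ht : smoothStepDiff t ≠ 0) : |t| ≤ 1 := by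
  rw [abs_le]
  by_contra! h
  apply ht
  rw [smoothStepDiff]
  by_cases h1 : -1 ≤ t
  · rw [Real.smoothTransition.one_of_one_le (by linarith [h h1]),
      Real.smoothTransition.one_of_one_le (h h1).le, sub_self]
  · rw [Real.smoothTransition.zero_of_nonpos (by linarith),
      Real.smoothTransition.zero_of_nonpos (by linarith), sub_self]

theorem hasSum_smoothStepDiff_sub_natCast {t : ℝ} (ht : 0 ≤ t) :
    HasSum (fun j : ℕ => smoothStepDiff (t - j)) 1 := by
  rw [hasSum_iff_tendsto_nat_of_nonneg fun j => smoothStepDiff_nonneg _]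
  have h : ∀ n : ℕ, ∑ j ∈ Finset.range n, smoothStepDiff (t - j) =
      1 - Real.smoothTransition (t + 1 - n) := fun n => by
    induction n with
    | zero => simp [Real.smoothTransition.one_of_one_le (show 1 ≤ t + 1 by linarith)]
    | succ n ih =>
      rw [Finset.sum_range_succ, ih, smoothStepDiff]
      push_cast
      rw [show t - n + 1 = t + 1 - n by ring, show t + 1 - (n + 1 : ℝ) = t - n by ring]
      ring
  refine tendsto_atTop_of_eventually_const (i₀ := ⌈t + 1⌉₊) fun n hn => ?_
  rw [h, Real.smoothTransition.zero_of_nonpos, sub_zero]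
  linarith [Nat.ceil_le.1 hn]

theorem exists_finset_sum_smoothStepDiff (t : ℝ) :
    ∃ F : Finset ℤ, (∀ k ∉ F, smoothStepDiff (t + k) = 0) ∧
      ∑ k ∈ F, smoothStepDiff (t + k) = 1 := by
  have hfin : (Function.support fun k : ℤ => smoothStepDiff (t + k)).Finite := by
    refine (Set.finite_Icc ⌈-1 - t⌉ ⌊1 - t⌋).subset fun k hk => ?_
    have := abs_le.1 (abs_le_one_of_smoothStepDiff_ne_zero hk)
    rw [Set.mem_Icc, Int.ceil_le, Int.le_floor]
    constructor <;> linarith [this.1, this.2]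
  have h1 := hasSum_smoothStepDiff_sub_natCast (t := Int.fract t + 1)
    (by linarith [Int.fract_nonneg t])
  have hinj : Function.Injective fun j : ℕ => 1 - ⌊t⌋ - (j : ℤ) := fun i j h => by
    simpa using h
  have h2 : HasSum (fun k : ℤ => smoothStepDiff (t + k)) 1 := by
    rw [← hinj.hasSum_iff]
    · convert h1 using 2 with j
      simp only [Function.comp]
      congr 1
      push_cast
      rw [Int.fract]
      ring
    · intro k hk
      by_contra h0
      have := (abs_le.1 (abs_le_one_of_smoothStepDiff_ne_zero h0)).2
      refine hk ⟨(1 - ⌊t⌋ - k).toNat, ?_⟩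
      have h3 : (k : ℝ) < 1 - ⌊t⌋ + 1 := by
        have := Int.floor_le t
        linarith
      have h4 : k < 1 - ⌊t⌋ + 1 := by exact_mod_cast h3
      simp only
      omega
  refine ⟨hfin.toFinset, fun k hk => by simpa using hk, ?_⟩
  refine HasSum.unique (hasSum_sum_of_ne_finset_zero fun k hk => ?_) h2
  simpa using hk

end Bump

section TestFunction

open scoped Classical

open NumberField.mixedEmbedding NumberField.mixedEmbedding.fundamentalCone NumberField.Units
  NumberField.Units.dirichletUnitTheorem

variable {K : Type*} [Field K] [NumberField K]

/-- The coordinates of a point of the mixed space with respect to the fundamental units. -/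
noncomputable def unitCoord (x : mixedSpace K) : Fin (rank K) → ℝ :=
  ((basisUnitLattice K).ofZLatticeBasis ℝ (unitLattice K)).equivFun (logMap x)

/-- The weight of a smooth partition of unity for the action of the units on the mixed space. -/
noncomputable def unitWeight (x : mixedSpace K) : ℝ :=
  ∏ i, smoothStepDiff (unitCoord x i)

theorem unitWeight_nonneg (x : mixedSpace K) : 0 ≤ unitWeight x :=
  Finset.prod_nonneg fun _ _ => smoothStepDiff_nonneg _

theorem unitWeight_smul {x : mixedSpace K} (hx : mixedEmbedding.norm x ≠ 0) {c : ℝ} (hc : c ≠ 0) :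
    unitWeight (c • x) = unitWeight x := by
  rw [unitWeight, unitCoord, logMap_real_smul hx hc, unitWeight, unitCoord]

/-- A unit as the product of a root of unity and powers of the fundamental units. -/
noncomputable def unitsProdEquiv :
    torsion K × (Fin (rank K) → ℤ) ≃ (𝓞 K)ˣ :=
  Equiv.ofBijective (fun p => p.1 * ∏ i, fundSystem K i ^ p.2 i)
    ⟨fun _ _ h => (exist_unique_eq_mul_prod K _).unique rfl h,
      fun u => (exist_unique_eq_mul_prod K u).exists.imp fun _ h => h.symm⟩

theorem unitCoord_unit_smul {x : mixedSpace K} (hx : mixedEmbedding.norm x ≠ 0)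
    (p : torsion K × (Fin (rank K) → ℤ)) (i : Fin (rank K)) :
    unitCoord (unitsProdEquiv p • x) i = unitCoord x i + p.2 i := by
  have h1 : logEmbedding K (Additive.ofMul (unitsProdEquiv p)) =
      ∑ i, (p.2 i : ℝ) • (basisUnitLattice K).ofZLatticeBasis ℝ (unitLattice K) i := by
    change logEmbedding K (Additive.ofMul (p.1 * ∏ i, fundSystem K i ^ p.2 i)) = _
    simp only [ofMul_mul, ofMul_prod, ofMul_zpow, map_add,
      map_sum, map_zsmul, logEmbedding_eq_zero_iff.2 p.1.2, zero_add, logEmbedding_fundSystem,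
      Basis.ofZLatticeBasis_apply, Int.cast_smul_eq_zsmul]
  rw [unitCoord, logMap_unit_smul _ hx, h1, map_add, Pi.add_apply, add_comm, unitCoord]
  congr 1
  rw [← Basis.equivFun_symm_apply, LinearEquiv.apply_symm_apply]

theorem hasSum_unitWeight_unit_smul {x : mixedSpace K} (hx : mixedEmbedding.norm x ≠ 0) :
    HasSum (fun u : (𝓞 K)ˣ => unitWeight (u • x)) (torsionOrder K) := by
  have := Fintype.ofFinite (torsion K)
  rw [← unitsProdEquiv.hasSum_iff]
  choose F hF hF' using fun i => exists_finset_sum_smoothStepDiff (unitCoord x i)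
  have h1 : ∑ p ∈ (Finset.univ : Finset (torsion K)) ×ˢ Fintype.piFinset F,
      unitWeight (unitsProdEquiv p • x) = torsionOrder K := by
    rw [Finset.sum_product]
    simp only [unitWeight, unitCoord_unit_smul hx]
    rw [← Finset.prod_univ_sum F fun i k => smoothStepDiff (unitCoord x i + k)]
    simp [hF', torsionOrder]
  rw [← h1]
  refine hasSum_sum_of_ne_finset_zero fun p hp => ?_
  rw [Finset.mem_product, not_and] at hp
  have := hp (Finset.mem_univ _)
  rw [Fintype.mem_piFinset, not_forall] at this
  obtain ⟨i, hi⟩ := this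
  rw [Function.comp, unitWeight]
  refine Finset.prod_eq_zero (Finset.mem_univ i) ?_
  rw [unitCoord_unit_smul hx]
  exact hF i _ hi

/-- A smooth function on the mixed space, depending on a complex parameter, whose dilates
decompose the product of `unitWeight` and a power of the norm. -/
noncomputable def testFun (p : ℂ × mixedSpace K) : ℂ :=
  if mixedEmbedding.norm p.2 = 0 then 0 else
    ((unitWeight p.2 * smoothStepDiff (Real.log (mixedEmbedding.norm p.2) / finrank ℚ K) : ℝ) : ℂ) *
      Complex.exp (-p.1 * (Real.log (mixedEmbedding.norm p.2) : ℝ))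

theorem testFun_of_norm_eq_zero (s : ℂ) {x : mixedSpace K} (hx : mixedEmbedding.norm x = 0) :
    testFun (s, x) = 0 := if_pos hx

theorem testFun_of_norm_ne_zero (s : ℂ) {x : mixedSpace K} (hx : mixedEmbedding.norm x ≠ 0) :
    testFun (s, x) =
      ((unitWeight x * smoothStepDiff (Real.log (mixedEmbedding.norm x) / finrank ℚ K) : ℝ) : ℂ) *
      Complex.exp (-s * (Real.log (mixedEmbedding.norm x) : ℝ)) := if_neg hx

theorem abs_log_norm_le_of_testFun_ne_zero {s : ℂ} {x : mixedSpace K} (h : testFun (s, x) ≠ 0) :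
    mixedEmbedding.norm x ≠ 0 ∧ |Real.log (mixedEmbedding.norm x)| ≤ finrank ℚ K ∧
      ∀ i, |unitCoord x i| ≤ 1 := by
  have hx : mixedEmbedding.norm x ≠ 0 := fun hx => h (testFun_of_norm_eq_zero s hx)
  rw [testFun_of_norm_ne_zero s hx] at h
  have h1 := left_ne_zero_of_mul h
  rw [Complex.ofReal_ne_zero] at h1
  have hn : (0 : ℝ) < finrank ℚ K := by exact_mod_cast finrank_pos
  refine ⟨hx, ?_, fun i => abs_le_one_of_smoothStepDiff_ne_zero
    (Finset.prod_ne_zero_iff.1 (left_ne_zero_of_mul h1) i (Finset.mem_univ i))⟩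
  have := abs_le_one_of_smoothStepDiff_ne_zero (right_ne_zero_of_mul h1)
  rwa [abs_div, abs_of_pos hn, div_le_one hn] at this

theorem exists_testFun_eq_zero (K : Type*) [Field K] [NumberField K] :
    ∃ R : ℝ, ∀ s, ∀ x : mixedSpace K, R < ‖x‖ → testFun (s, x) = 0 := by
  obtain ⟨n, hn⟩ : ∃ n : ℝ, n = finrank ℚ K := ⟨_, rfl⟩
  have hn1 : 1 ≤ n := by
    rw [hn]
    exact_mod_cast (finrank_pos : 0 < finrank ℚ K)
  set B := (basisUnitLattice K).ofZLatticeBasis ℝ (unitLattice K) with hB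
  set A := ∑ i, ‖B i‖ with hA
  have hA0 : 0 ≤ A := Finset.sum_nonneg fun i _ => norm_nonneg _
  refine ⟨Real.exp (n + n * (A + 1)), fun s x hR => ?_⟩
  by_contra h
  obtain ⟨hx, hlog, hcoord⟩ := abs_log_norm_le_of_testFun_ne_zero h
  rw [← hn] at hlog
  refine hR.not_ge ?_
  have hpos : ∀ w, 0 < normAtPlace w x := fun w =>
    lt_of_le_of_ne (normAtPlace_nonneg w x) (mixedEmbedding.norm_ne_zero_iff.1 hx w).symm
  have hlogMap : ‖logMap x‖ ≤ A := by
    rw [← B.sum_equivFun (logMap x)]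
    refine (norm_sum_le _ _).trans (Finset.sum_le_sum fun i _ => ?_)
    rw [_root_.norm_smul]
    exact mul_le_of_le_one_left (norm_nonneg _) (hcoord i)
  have hw : ∀ w, w ≠ w₀ → |Real.log (normAtPlace w x)| ≤ A + 1 := fun w hw => by
    have h1 := (norm_le_pi_norm (logMap x) ⟨w, hw⟩).trans hlogMap
    rw [logMap_apply, Real.norm_eq_abs, abs_mul, ← hn] at h1
    have h2 : (1 : ℝ) ≤ |(w.mult : ℝ)| := by
      rw [Nat.abs_cast]; exact_mod_cast w.mult_pos
    have h3 := (le_mul_of_one_le_left (abs_nonneg _) h2).trans h1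
    have h4 : |Real.log (mixedEmbedding.norm x) * n⁻¹| ≤ 1 := by
      rw [← div_eq_mul_inv, abs_div, abs_of_pos (by linarith : 0 < n), div_le_one (by linarith)]
      exact hlog
    have := abs_sub_abs_le_abs_sub (Real.log (normAtPlace w x))
      (Real.log (mixedEmbedding.norm x) * n⁻¹)
    linarith
  have hsum : ∑ w : InfinitePlace K, (w.mult : ℝ) * Real.log (normAtPlace w x) =
      Real.log (mixedEmbedding.norm x) := by
    rw [mixedEmbedding.norm_apply, Real.log_prod fun w _ => (pow_pos (hpos w) _).ne']
    exact Finset.sum_congr rfl fun w _ => (Real.log_pow _ _).symm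
  have hw0 : Real.log (normAtPlace w₀ x) ≤ n + n * (A + 1) := by
    classical
    rw [← Finset.add_sum_erase _ _ (Finset.mem_univ (w₀ : InfinitePlace K))] at hsum
    have h1 : -∑ w ∈ Finset.univ.erase (w₀ : InfinitePlace K),
        (w.mult : ℝ) * Real.log (normAtPlace w x) ≤ n * (A + 1) := by
      rw [← Finset.sum_neg_distrib]
      calc _ ≤ ∑ w ∈ Finset.univ.erase (w₀ : InfinitePlace K), (w.mult : ℝ) * (A + 1) := by
            refine Finset.sum_le_sum fun w h => ?_
            rw [← mul_neg]
            gcongr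
            exact (neg_le_abs _).trans (hw w (Finset.ne_of_mem_erase h))
        _ ≤ ∑ w : InfinitePlace K, (w.mult : ℝ) * (A + 1) :=
            Finset.sum_le_sum_of_subset_of_nonneg (Finset.subset_univ _)
              fun _ _ _ => by positivity
        _ = _ := by
            rw [← Finset.sum_mul, hn, ← InfinitePlace.sum_mult_eq (K := K)]
            push_cast
            rfl
    rcases le_or_gt (Real.log (normAtPlace w₀ x)) 0 with h0 | h0
    · exact h0.trans (add_nonneg (by linarith) (mul_nonneg (by linarith) (by linarith)))
    · have h2 : (1 : ℝ) ≤ (w₀ : InfinitePlace K).mult := by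
        exact_mod_cast (w₀ : InfinitePlace K).mult_pos
      have h3 := le_mul_of_one_le_left h0.le h2
      have := (abs_le.1 hlog).2
      linarith
  rw [norm_eq_sup'_normAtPlace]
  refine Finset.sup'_le _ _ fun w _ => ?_
  rw [← Real.log_le_iff_le_exp (hpos w)]
  by_cases h0 : w = w₀
  · rw [h0]; exact hw0
  · have := (abs_le.1 (hw w h0)).2
    nlinarith

theorem contDiffAt_normAtPlace {w : InfinitePlace K} {x : mixedSpace K}
    (hx : normAtPlace w x ≠ 0) : ContDiffAt ℝ ∞ (fun y => normAtPlace w y) x := by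
  by_cases hw : w.IsReal
  · simp only [normAtPlace_apply_of_isReal hw] at hx ⊢
    exact ContDiffAt.norm ℝ (by fun_prop) (norm_ne_zero_iff.1 hx)
  · rw [InfinitePlace.not_isReal_iff_isComplex] at hw
    simp only [normAtPlace_apply_of_isComplex hw] at hx ⊢
    exact ContDiffAt.norm ℝ (by fun_prop) (norm_ne_zero_iff.1 hx)

theorem contDiffAt_mixedEmbedding_norm {x : mixedSpace K} (hx : mixedEmbedding.norm x ≠ 0) :
    ContDiffAt ℝ ∞ (fun y => mixedEmbedding.norm y) x := by
  simp only [mixedEmbedding.norm_apply]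
  exact contDiffAt_prod fun w _ =>
    (contDiffAt_normAtPlace (mixedEmbedding.norm_ne_zero_iff.1 hx w)).pow _

theorem contDiffAt_logMap {x : mixedSpace K} (hx : mixedEmbedding.norm x ≠ 0) :
    ContDiffAt ℝ ∞ (fun y : mixedSpace K => logMap y) x := by
  refine contDiffAt_pi.2 fun w => ?_
  simp only [logMap_apply]
  exact contDiffAt_const.mul
    (((contDiffAt_normAtPlace (mixedEmbedding.norm_ne_zero_iff.1 hx w)).log
      (mixedEmbedding.norm_ne_zero_iff.1 hx w)).sub
      (((contDiffAt_mixedEmbedding_norm hx).log hx).mul contDiffAt_const))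

theorem contDiffAt_unitWeight {x : mixedSpace K} (hx : mixedEmbedding.norm x ≠ 0) :
    ContDiffAt ℝ ∞ (fun y : mixedSpace K => unitWeight y) x := by
  refine contDiffAt_prod fun i _ => contDiff_smoothStepDiff.contDiffAt.comp x ?_
  have h : ContDiff ℝ ∞ ((LinearMap.toContinuousLinearMap
      (((basisUnitLattice K).ofZLatticeBasis ℝ (unitLattice K)).coord i))) :=
    ContinuousLinearMap.contDiff _
  exact h.contDiffAt.comp x (contDiffAt_logMap hx)

theorem contDiff_testFun (K : Type*) [Field K] [NumberField K] :
    ContDiff ℝ ∞ (testFun (K := K)) := by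
  rw [contDiff_iff_contDiffAt]
  rintro ⟨s, x⟩
  have hcont : Continuous fun p : ℂ × mixedSpace K => mixedEmbedding.norm p.2 :=
    (mixedEmbedding.continuous_norm K).comp continuous_snd
  by_cases hx : mixedEmbedding.norm x = 0
  · refine (contDiffAt_const (c := (0 : ℂ))).congr_of_eventuallyEq ?_
    filter_upwards [hcont.continuousAt.eventually_lt_const
      (show mixedEmbedding.norm x < Real.exp (-finrank ℚ K) by rw [hx]; positivity)] with p hp
    by_contra h
    obtain ⟨h0, h1, -⟩ := abs_log_norm_le_of_testFun_ne_zero (s := p.1) (x := p.2) h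
    have h2 := (Real.le_log_iff_exp_le
      (lt_of_le_of_ne (mixedEmbedding.norm_nonneg p.2) h0.symm)).1 (abs_le.1 h1).1
    exact h2.not_gt hp
  · have hlog : ContDiffAt ℝ ∞
        (fun p : ℂ × mixedSpace K => Real.log (mixedEmbedding.norm p.2)) (s, x) :=
      ((contDiffAt_mixedEmbedding_norm hx).comp (s, x) contDiffAt_snd).log hx
    have hwt : ContDiffAt ℝ ∞ (fun p : ℂ × mixedSpace K => unitWeight p.2) (s, x) :=
      ContDiffAt.comp (g := fun y : mixedSpace K => unitWeight y) (s, x)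
        (contDiffAt_unitWeight hx) contDiffAt_snd
    have hof : ∀ {f : ℂ × mixedSpace K → ℝ}, ContDiffAt ℝ ∞ f (s, x) →
        ContDiffAt ℝ ∞ (fun p => (f p : ℂ)) (s, x) := fun hf =>
      Complex.ofRealCLM.contDiff.contDiffAt.comp (s, x) hf
    refine ContDiffAt.congr_of_eventuallyEq (f := fun p : ℂ × mixedSpace K =>
      ((unitWeight p.2 *
        smoothStepDiff (Real.log (mixedEmbedding.norm p.2) / finrank ℚ K) : ℝ) : ℂ) *
      Complex.exp (-p.1 * (Real.log (mixedEmbedding.norm p.2) : ℝ))) ?_ ?_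
    · refine (hof (hwt.mul (contDiff_smoothStepDiff.contDiffAt.comp (s, x)
        (hlog.div_const _)))).mul (ContDiffAt.cexp ?_)
      exact contDiffAt_fst.neg.mul (hof hlog)
    · filter_upwards [hcont.continuousAt.eventually_ne hx] with p hp
      exact testFun_of_norm_ne_zero p.1 hp

theorem differentiable_testFun (x : mixedSpace K) : Differentiable ℂ fun s => testFun (s, x) := by
  by_cases hx : mixedEmbedding.norm x = 0
  · simp only [testFun_of_norm_eq_zero _ hx]
    fun_prop
  · simp only [testFun_of_norm_ne_zero _ hx]
    fun_prop

theorem testFun_smul (s : ℂ) {x : mixedSpace K} (hx : mixedEmbedding.norm x ≠ 0) (j : ℕ) :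
    Complex.exp (-(j * finrank ℚ K) * s) * testFun (s, Real.exp (-j) • x) =
      ((unitWeight x * smoothStepDiff (Real.log (mixedEmbedding.norm x) / finrank ℚ K - j) : ℝ) : ℂ)
        * (mixedEmbedding.norm x : ℂ) ^ (-s) := by
  have hn : (finrank ℚ K : ℝ) ≠ 0 := by exact_mod_cast (finrank_pos : 0 < finrank ℚ K).ne'
  have h1 : mixedEmbedding.norm (Real.exp (-j) • x) =
      Real.exp (-j * finrank ℚ K) * mixedEmbedding.norm x := by
    rw [mixedEmbedding.norm_smul, abs_of_pos (Real.exp_pos _), ← Real.exp_nat_mul, mul_comm (-j : ℝ)]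
  have h2 : mixedEmbedding.norm (Real.exp (-j) • x) ≠ 0 := by
    rw [h1]; exact mul_ne_zero (Real.exp_ne_zero _) hx
  rw [testFun_of_norm_ne_zero s h2, unitWeight_smul hx (Real.exp_ne_zero _), h1,
    Real.log_mul (Real.exp_ne_zero _) hx, Real.log_exp,
    Complex.cpow_def_of_ne_zero (by exact_mod_cast hx),
    ← Complex.ofReal_log (mixedEmbedding.norm_nonneg x), mul_left_comm, ← Complex.exp_add]
  congr 2
  · congr 3
    field_simp
    ring
  · push_cast
    ring

end TestFunction

section Character

open scoped nonZeroDivisors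

variable {K : Type*} [Field K] [NumberField K]

/-- Every ideal class contains an ideal coprime to a given nontrivial ideal. -/
theorem exists_isCoprime_mk0_eq {R : Type*} [CommRing R] [IsDedekindDomain R] {𝔪 : Ideal R}
    (h𝔪 : 𝔪 ≠ ⊥) (h𝔪' : 𝔪 ≠ ⊤) (k : ClassGroup R) :
    ∃ 𝔟 : (Ideal R)⁰, IsCoprime (𝔟 : Ideal R) 𝔪 ∧ ClassGroup.mk0 𝔟 = k := by
  obtain ⟨J, hJ⟩ := ClassGroup.mk0_surjective k⁻¹
  have hJ0 : (J : Ideal R) ≠ 0 := nonZeroDivisors.coe_ne_zero J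
  obtain ⟨a, ha⟩ := IsDedekindDomain.exists_sup_span_eq
    (Ideal.mul_le_inf.trans inf_le_left : (J : Ideal R) * 𝔪 ≤ J) (mul_ne_zero hJ0 h𝔪)
  obtain ⟨𝔠, h𝔠⟩ : (J : Ideal R) ∣ Ideal.span {a} :=
    Ideal.dvd_iff_le.2 (le_sup_right.trans ha.le)
  rw [h𝔠, ← Ideal.mul_sup] at ha
  have hsup : 𝔪 ⊔ 𝔠 = ⊤ := mul_left_cancel₀ hJ0 (ha.trans (Ideal.mul_top _).symm)
  have h𝔠0 : 𝔠 ≠ ⊥ := by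
    rintro rfl
    exact h𝔪' (by simpa using hsup)
  refine ⟨⟨𝔠, mem_nonZeroDivisors_iff_ne_zero.2 h𝔠0⟩,
    Ideal.isCoprime_iff_sup_eq.2 (by rwa [sup_comm]), ?_⟩
  have hk : k = (ClassGroup.mk0 J)⁻¹ := by rw [hJ, inv_inv]
  rw [hk, ClassGroup.mk0_eq_mk0_inv_iff]
  refine ⟨a, ?_, by rw [h𝔠, mul_comm]⟩
  rintro rfl
  rw [Ideal.span_singleton_zero] at h𝔠
  exact mul_ne_zero hJ0 h𝔠0 h𝔠.symm

theorem isCoprime_span_singleton_left_iff {R : Type*} [CommRing R] {𝔪 : Ideal R} {x : R} :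
    IsCoprime (Ideal.span {x}) 𝔪 ↔ ∃ e, e * x - 1 ∈ 𝔪 := by
  rw [Ideal.isCoprime_iff_exists]
  constructor
  · rintro ⟨i, hi, j, hj, hij⟩
    obtain ⟨e, rfl⟩ := Ideal.mem_span_singleton'.1 hi
    exact ⟨e, by rw [← hij, sub_add_cancel_left]; exact 𝔪.neg_mem hj⟩
  · rintro ⟨e, he⟩
    exact ⟨e * x, Ideal.mem_span_singleton'.2 ⟨e, rfl⟩, 1 - e * x, by
      rw [← neg_sub]; exact 𝔪.neg_mem he, by ring⟩

/-- A quadratic Hecke character of trivial infinite type modulo `𝔪`. -/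
structure IsQuadraticHeckeCharacter (𝔪 : Ideal (𝓞 K)) (ψ : Ideal (𝓞 K) → ℤ) : Prop where
  ne_bot : 𝔪 ≠ ⊥
  ne_top : 𝔪 ≠ ⊤
  val : ∀ I, ψ I = 0 ∨ ψ I = 1 ∨ ψ I = -1
  mul : ∀ I J, ψ (I * J) = ψ I * ψ J
  vanish : ∀ I, ¬ IsCoprime I 𝔪 → ψ I = 0
  principal : ∀ a : 𝓞 K, a - 1 ∈ 𝔪 → ψ (Ideal.span {a}) = 1

namespace IsQuadraticHeckeCharacter

variable {𝔪 : Ideal (𝓞 K)} {ψ : Ideal (𝓞 K) → ℤ}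

theorem abs_le_one (h : IsQuadraticHeckeCharacter 𝔪 ψ) (I : Ideal (𝓞 K)) : |ψ I| ≤ 1 := by
  rcases h.val I with h | h | h <;> simp [h]

theorem span_ne_zero (h : IsQuadraticHeckeCharacter 𝔪 ψ) {x : 𝓞 K}
    (hx : IsCoprime (Ideal.span {x}) 𝔪) : ψ (Ideal.span {x}) ≠ 0 := by
  obtain ⟨e, he⟩ := isCoprime_span_singleton_left_iff.1 hx
  have := h.principal _ he
  rw [← Ideal.span_singleton_mul_span_singleton, h.mul] at this
  intro h0
  simp [h0] at this

theorem ne_bot_of_isCoprime (h : IsQuadraticHeckeCharacter 𝔪 ψ) {I : Ideal (𝓞 K)}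
    (hI : IsCoprime I 𝔪) : I ≠ ⊥ := by
  rintro rfl
  exact h.ne_top (by simpa using Ideal.isCoprime_iff_sup_eq.1 hI)

/-- An ideal coprime to the modulus has a multiple, by an ideal coprime to the modulus
in a prescribed class, which is principal. -/
theorem exists_mul_eq_span (h : IsQuadraticHeckeCharacter 𝔪 ψ) {I : Ideal (𝓞 K)}
    (hI : IsCoprime I 𝔪) : ∃ J, IsCoprime J 𝔪 ∧ ∃ x, I * J = Ideal.span {x} := by
  obtain ⟨J, hJ, hJ'⟩ := exists_isCoprime_mk0_eq h.ne_bot h.ne_top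
    (ClassGroup.mk0 ⟨I, mem_nonZeroDivisors_iff_ne_zero.2 (h.ne_bot_of_isCoprime hI)⟩)⁻¹
  obtain ⟨x, -, hx⟩ := ClassGroup.mk0_eq_mk0_inv_iff.1 hJ'
  exact ⟨J, hJ, x, by rw [mul_comm]; exact hx⟩

theorem ne_zero (h : IsQuadraticHeckeCharacter 𝔪 ψ) {I : Ideal (𝓞 K)}
    (hI : IsCoprime I 𝔪) : ψ I ≠ 0 := by
  obtain ⟨J, hJ, x, hx⟩ := h.exists_mul_eq_span hI
  have := h.span_ne_zero (x := x) (hx ▸ hI.mul_left hJ)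
  rw [← hx, h.mul] at this
  exact left_ne_zero_of_mul this

theorem mul_self (h : IsQuadraticHeckeCharacter 𝔪 ψ) {I : Ideal (𝓞 K)}
    (hI : IsCoprime I 𝔪) : ψ I * ψ I = 1 := by
  rcases h.val I with h0 | h0 | h0
  · exact absurd h0 (h.ne_zero hI)
  all_goals simp [h0]

theorem span_eq_of_sub_mem (h : IsQuadraticHeckeCharacter 𝔪 ψ) {x y : 𝓞 K} (hxy : x - y ∈ 𝔪) :
    ψ (Ideal.span {x}) = ψ (Ideal.span {y}) := by
  have key : ∀ {x y : 𝓞 K}, x - y ∈ 𝔪 → IsCoprime (Ideal.span {x}) 𝔪 →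
      ψ (Ideal.span {x}) = ψ (Ideal.span {y}) := by
    intro x y hxy hx
    obtain ⟨e, he⟩ := isCoprime_span_singleton_left_iff.1 hx
    have he' : e * y - 1 ∈ 𝔪 := by
      have := 𝔪.sub_mem he (𝔪.mul_mem_left e hxy)
      rwa [show e * x - 1 - e * (x - y) = e * y - 1 by ring] at this
    have h1 := h.principal _ he
    have h2 := h.principal _ he'
    rw [← Ideal.span_singleton_mul_span_singleton, h.mul] at h1 h2
    exact mul_left_cancel₀ (left_ne_zero_of_mul_eq_one h1) (h1.trans h2.symm)
  by_cases hx : IsCoprime (Ideal.span {x}) 𝔪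
  · exact key hxy hx
  by_cases hy : IsCoprime (Ideal.span {y}) 𝔪
  · exact (key (by rw [← neg_sub]; exact 𝔪.neg_mem hxy) hy).symm
  · rw [h.vanish _ hx, h.vanish _ hy]

/-- The value of the character on a principal ideal, as a function on the residue ring. -/
noncomputable def residue (_h : IsQuadraticHeckeCharacter 𝔪 ψ) (r : 𝓞 K ⧸ 𝔪) : ℤ :=
  ψ (Ideal.span {Quotient.out r})

theorem residue_mk (h : IsQuadraticHeckeCharacter 𝔪 ψ) (x : 𝓞 K) :
    h.residue (Ideal.Quotient.mk 𝔪 x) = ψ (Ideal.span {x}) :=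
  h.span_eq_of_sub_mem (Ideal.Quotient.eq.1 (Ideal.Quotient.mk_out _))

theorem residue_mul (h : IsQuadraticHeckeCharacter 𝔪 ψ) (r t : 𝓞 K ⧸ 𝔪) :
    h.residue (r * t) = h.residue r * h.residue t := by
  obtain ⟨x, rfl⟩ := Ideal.Quotient.mk_surjective r
  obtain ⟨y, rfl⟩ := Ideal.Quotient.mk_surjective t
  rw [← map_mul, residue_mk, residue_mk, residue_mk, ← Ideal.span_singleton_mul_span_singleton,
    h.mul]

theorem sum_residue_eq_zero [Fintype (𝓞 K ⧸ 𝔪)] (h : IsQuadraticHeckeCharacter 𝔪 ψ) {x : 𝓞 K}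
    (hx : ψ (Ideal.span {x}) = -1) : ∑ r, h.residue r = 0 := by
  have hxc : IsCoprime (Ideal.span {x}) 𝔪 := by
    by_contra h0
    simp [h.vanish _ h0] at hx
  obtain ⟨e, he⟩ := isCoprime_span_singleton_left_iff.1 hxc
  have hunit : IsUnit (Ideal.Quotient.mk 𝔪 x) := by
    refine IsUnit.of_mul_eq_one (Ideal.Quotient.mk 𝔪 e) ?_
    rw [← map_mul, mul_comm, ← map_one (Ideal.Quotient.mk 𝔪)]
    exact Ideal.Quotient.eq.2 he
  have h1 := hunit.unit.mulLeft_bijective.sum_comp h.residue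
  simp only [IsUnit.unit_spec, residue_mul, residue_mk, hx, neg_mul, one_mul,
    Finset.sum_neg_distrib] at h1
  omega

theorem eq_of_mk0_eq (h : IsQuadraticHeckeCharacter 𝔪 ψ)
    (h1 : ∀ x, IsCoprime (Ideal.span {x}) 𝔪 → ψ (Ideal.span {x}) = 1) {I J : (Ideal (𝓞 K))⁰}
    (hI : IsCoprime (I : Ideal (𝓞 K)) 𝔪) (hJ : IsCoprime (J : Ideal (𝓞 K)) 𝔪)
    (hIJ : ClassGroup.mk0 I = ClassGroup.mk0 J) : ψ I = ψ J := by
  obtain ⟨C, hC, hC'⟩ := exists_isCoprime_mk0_eq h.ne_bot h.ne_top (ClassGroup.mk0 I)⁻¹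
  obtain ⟨x, -, hx⟩ := ClassGroup.mk0_eq_mk0_inv_iff.1 hC'
  obtain ⟨y, -, hy⟩ := ClassGroup.mk0_eq_mk0_inv_iff.1 (hIJ ▸ hC')
  have hx1 := h1 x (hx ▸ hC.mul_left hI)
  have hy1 := h1 y (hy ▸ hC.mul_left hJ)
  rw [← hx, h.mul] at hx1
  rw [← hy, h.mul] at hy1
  exact mul_left_cancel₀ (h.ne_zero hC) (hx1.trans hy1.symm)

theorem sum_mul_sum_residue_eq_zero [Fintype (𝓞 K ⧸ 𝔪)] (h : IsQuadraticHeckeCharacter 𝔪 ψ)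
    {𝔟 : ClassGroup (𝓞 K) → (Ideal (𝓞 K))⁰}
    (h𝔟 : ∀ k, IsCoprime (𝔟 k : Ideal (𝓞 K)) 𝔪) (h𝔟' : ∀ k, ClassGroup.mk0 (𝔟 k) = k)
    {A : Ideal (𝓞 K)} (hA : IsCoprime A 𝔪) (hA' : ψ A ≠ 1) :
    (∑ k, ψ (𝔟 k)) * ∑ r, h.residue r = 0 := by
  by_cases hx : ∃ x, ψ (Ideal.span {x}) = -1
  · obtain ⟨x, hx⟩ := hx
    rw [h.sum_residue_eq_zero hx, mul_zero]
  push Not at hx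
  have h1 : ∀ x, IsCoprime (Ideal.span {x}) 𝔪 → ψ (Ideal.span {x}) = 1 := fun x hxc => by
    rcases h.val (Ideal.span {x}) with h0 | h0 | h0
    · exact absurd h0 (h.ne_zero hxc)
    · exact h0
    · exact absurd h0 (hx x)
  have hA1 : ψ A = -1 := by
    rcases h.val A with h0 | h0 | h0
    · exact absurd h0 (h.ne_zero hA)
    · exact absurd h0 hA'
    · exact h0
  let A' : (Ideal (𝓞 K))⁰ := ⟨A, mem_nonZeroDivisors_iff_ne_zero.2 (h.ne_bot_of_isCoprime hA)⟩
  have h2 : ∀ k, ψ (𝔟 (ClassGroup.mk0 A' * k)) = -ψ (𝔟 k) := fun k => by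
    have h3 : ψ (𝔟 (ClassGroup.mk0 A' * k)) = ψ (A' * 𝔟 k : (Ideal (𝓞 K))⁰) :=
      h.eq_of_mk0_eq h1 (h𝔟 _) (by simpa [A'] using hA.mul_left (h𝔟 k)) (by
        rw [h𝔟', map_mul, h𝔟'])
    rw [h3, Submonoid.coe_mul, h.mul]
    simp [A', hA1]
  have h4 := Equiv.sum_comp (Equiv.mulLeft (ClassGroup.mk0 A')) (fun k => ψ (𝔟 k))
  simp only [Equiv.coe_mulLeft, h2, Finset.sum_neg_distrib] at h4
  rw [show ∑ k, ψ (𝔟 k) = 0 by omega, zero_mul]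

end IsQuadraticHeckeCharacter

end Character

section IdealLattice

open scoped Classical nonZeroDivisors

open NumberField.mixedEmbedding MeasureTheory

variable {K : Type*} [Field K] [NumberField K]

/-- The lattice basis of the mixed space attached to a nonzero integral ideal. -/
noncomputable abbrev idealLatticeBasis (J : (Ideal (𝓞 K))⁰) :=
  fractionalIdealLatticeBasis K (FractionalIdeal.mk0 K J)

theorem mem_span_idealLatticeBasis (J : (Ideal (𝓞 K))⁰) (v : mixedSpace K) :
    v ∈ Submodule.span ℤ (Set.range (idealLatticeBasis J)) ↔
      ∃ x ∈ (J : Ideal (𝓞 K)), mixedEmbedding K x = v := by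
  rw [mem_span_fractionalIdealLatticeBasis]
  simp [FractionalIdeal.mem_coeIdeal]

theorem volume_real_fundamentalDomain_idealLatticeBasis (J : (Ideal (𝓞 K))⁰) :
    volume.real (ZSpan.fundamentalDomain (idealLatticeBasis J)) =
      Ideal.absNorm (J : Ideal (𝓞 K)) *
        volume.real (ZSpan.fundamentalDomain (latticeBasis K)) := by
  rw [Measure.real, volume_fundamentalDomain_fractionalIdealLatticeBasis, ENNReal.toReal_mul,
    Measure.real, FractionalIdeal.coe_mk0, FractionalIdeal.coeIdeal_absNorm]
  simp

theorem exists_residue_equiv {𝔪 𝔟 : Ideal (𝓞 K)} (h : IsCoprime 𝔟 𝔪)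
    {L : Submodule ℤ (mixedSpace K)}
    (hL : ∀ v, v ∈ L ↔ ∃ x ∈ 𝔟 * 𝔪, mixedEmbedding K (x : 𝓞 K) = v) :
    ∃ a : 𝓞 K ⧸ 𝔪 → 𝓞 K, ∃ e : (𝓞 K ⧸ 𝔪) × L ≃ 𝔟, ∀ r v,
      mixedEmbedding K (e (r, v) : 𝓞 K) = mixedEmbedding K (a r) + v ∧
        Ideal.Quotient.mk 𝔪 (e (r, v)) = r := by
  have ha : ∀ r : 𝓞 K ⧸ 𝔪, ∃ x ∈ 𝔟, Ideal.Quotient.mk 𝔪 x = r := fun r => by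
    obtain ⟨y, rfl⟩ := Ideal.Quotient.mk_surjective r
    obtain ⟨i, hi, j, hj, hij⟩ := Ideal.isCoprime_iff_exists.1 h
    refine ⟨y * i, Ideal.mul_mem_left _ _ hi, Ideal.Quotient.eq.2 ?_⟩
    have : y * i - y = -(y * j) := by
      rw [sub_eq_iff_eq_add, neg_add_eq_sub, eq_sub_iff_add_eq, ← mul_add, hij, mul_one]
    rw [this]
    exact 𝔪.neg_mem (𝔪.mul_mem_left _ hj)
  choose a ha ha' using ha
  have hinj : ∀ x y : 𝓞 K, mixedEmbedding K x = mixedEmbedding K y → x = y := fun x y hxy =>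
    RingOfIntegers.coe_injective (mixedEmbedding_injective K hxy)
  choose w hw hw' using fun v : L => (hL v).1 v.2
  have hw𝔪 : ∀ v, Ideal.Quotient.mk 𝔪 (w v) = 0 := fun v =>
    Ideal.Quotient.eq_zero_iff_mem.2 (Ideal.mul_le_inf (hw v)).2
  let f : (𝓞 K ⧸ 𝔪) × L → 𝔟 :=
    fun p => ⟨a p.1 + w p.2, Ideal.add_mem _ (ha _) (Ideal.mul_le_inf (hw _)).1⟩
  have hf : Function.Bijective f := by
    constructor
    · rintro ⟨r, v⟩ ⟨r', v'⟩ hrv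
      have h1 : a r + w v = a r' + w v' := congrArg Subtype.val hrv
      have h2 : r = r' := by
        have := congrArg (Ideal.Quotient.mk 𝔪) h1
        simpa only [map_add, ha', hw𝔪, add_zero] using this
      subst h2
      have h3 : w v = w v' := add_left_cancel h1
      have h4 : v = v' := Subtype.ext (by rw [← hw', ← hw', h3])
      rw [h4]
    · rintro ⟨x, hx⟩
      have h1 : x - a (Ideal.Quotient.mk 𝔪 x) ∈ 𝔟 * 𝔪 := by
        rw [Ideal.mul_eq_inf_of_isCoprime h]
        exact ⟨Ideal.sub_mem _ hx (ha _), Ideal.Quotient.eq.1 (ha' _).symm⟩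
      obtain ⟨v, hv⟩ : ∃ v : L, w v = x - a (Ideal.Quotient.mk 𝔪 x) :=
        ⟨⟨_, (hL _).2 ⟨_, h1, rfl⟩⟩, hinj _ _ (hw' _)⟩
      exact ⟨⟨Ideal.Quotient.mk 𝔪 x, v⟩, Subtype.ext (by simp only [f, hv, add_sub_cancel])⟩
  refine ⟨a, Equiv.ofBijective f hf, fun r v => ⟨?_, ?_⟩⟩
  · simp only [Equiv.ofBijective_apply, f, map_add, hw']
  · simp only [Equiv.ofBijective_apply, f, map_add, ha', hw𝔪, add_zero]

theorem exists_residue_equiv_idealLatticeBasis {𝔪 : Ideal (𝓞 K)} {𝔟 : (Ideal (𝓞 K))⁰}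
    (h𝔪 : 𝔪 ≠ ⊥) (h : IsCoprime (𝔟 : Ideal (𝓞 K)) 𝔪) :
    ∃ J : (Ideal (𝓞 K))⁰, (J : Ideal (𝓞 K)) = 𝔟 * 𝔪 ∧ ∃ a : 𝓞 K ⧸ 𝔪 → 𝓞 K,
      ∃ e : (𝓞 K ⧸ 𝔪) × Submodule.span ℤ (Set.range (idealLatticeBasis J)) ≃
        (𝔟 : Ideal (𝓞 K)), ∀ r v,
          mixedEmbedding K (e (r, v) : 𝓞 K) = mixedEmbedding K (a r) + v ∧
            Ideal.Quotient.mk 𝔪 (e (r, v)) = r :=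
  ⟨⟨_, mem_nonZeroDivisors_iff_ne_zero.2 (mul_ne_zero (nonZeroDivisors.coe_ne_zero 𝔟) h𝔪)⟩, rfl,
    exists_residue_equiv h (mem_span_idealLatticeBasis _)⟩

/-- The sum of `Φ` over an ideal, weighted by a character and scaled by `u`. -/
noncomputable def idealSum (ψ : Ideal (𝓞 K) → ℤ) (𝔟 : (Ideal (𝓞 K))⁰)
    (Φ : ℂ × mixedSpace K → ℂ) (s : ℂ) (u : ℝ) : ℂ :=
  ∑' x : (𝔟 : Ideal (𝓞 K)), (ψ (Ideal.span {(x : 𝓞 K)}) : ℂ) * Φ (s, u • mixedEmbedding K (x : 𝓞 K))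

namespace IsQuadraticHeckeCharacter

variable {𝔪 : Ideal (𝓞 K)} {ψ : Ideal (𝓞 K) → ℤ} {𝔟 : (Ideal (𝓞 K))⁰}
  {Φ : ℂ × mixedSpace K → ℂ} {R : ℝ}

theorem exists_finset_eq_zero (h : IsQuadraticHeckeCharacter 𝔪 ψ)
    (h𝔟 : IsCoprime (𝔟 : Ideal (𝓞 K)) 𝔪) (h0 : ∀ s x, R < ‖x‖ → Φ (s, x) = 0) {u : ℝ}
    (hu : 0 < u) :
    ∃ F : Finset (𝔟 : Ideal (𝓞 K)), ∀ s, ∀ x ∉ F, Φ (s, u • mixedEmbedding K (x : 𝓞 K)) = 0 := by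
  have := Ideal.finiteQuotientOfFreeOfNeBot 𝔪 h.ne_bot
  have := Fintype.ofFinite (𝓞 K ⧸ 𝔪)
  obtain ⟨J, -, a, e, he⟩ := exists_residue_equiv_idealLatticeBasis h.ne_bot h𝔟
  obtain ⟨F, hF⟩ := exists_finset_latticeSum_eq (idealLatticeBasis J) h0 hu
    (∑ r, ‖mixedEmbedding K (a r)‖)
  refine ⟨(Finset.univ ×ˢ F).map e.toEmbedding, fun s x hx => ?_⟩
  obtain ⟨⟨r, v⟩, rfl⟩ := e.surjective x
  rw [(he r v).1]
  refine (hF s _ ?_).1 v fun hv => hx (Finset.mem_map_of_mem _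
    (Finset.mem_product.2 ⟨Finset.mem_univ _, hv⟩))
  exact Finset.single_le_sum (f := fun r => ‖mixedEmbedding K (a r)‖)
    (fun _ _ => norm_nonneg _) (Finset.mem_univ r)

theorem exists_norm_idealSum_sub_le [Fintype (𝓞 K ⧸ 𝔪)] (h : IsQuadraticHeckeCharacter 𝔪 ψ)
    (h𝔟 : IsCoprime (𝔟 : Ideal (𝓞 K)) 𝔪) (hΦ : ContDiff ℝ ∞ Φ)
    (h0 : ∀ s x, R < ‖x‖ → Φ (s, x) = 0) (S : ℝ) (N : ℕ) :
    ∃ C : ℝ, 0 ≤ C ∧ ∀ s, ‖s‖ ≤ S → ∀ u : ℝ, 0 < u → u ≤ 1 →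
      ‖idealSum ψ 𝔟 Φ s u - (∑ r, h.residue r : ℤ) *
        (((u ^ finrank ℚ K * (Ideal.absNorm (𝔟 : Ideal (𝓞 K)) * Ideal.absNorm 𝔪 *
          volume.real (ZSpan.fundamentalDomain (latticeBasis K))))⁻¹ : ℝ) *
            ∫ x, Φ (s, x))‖ ≤ C * u ^ N := by
  obtain ⟨J, hJ, a, e, he⟩ := exists_residue_equiv_idealLatticeBasis h.ne_bot h𝔟
  obtain ⟨C, hC0, hC⟩ := exists_norm_latticeSum_sub_integral_le (idealLatticeBasis J)
    (volume : Measure (mixedSpace K)) hΦ h0 S N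
  refine ⟨Fintype.card (𝓞 K ⧸ 𝔪) * C, by positivity, fun s hs u hu hu1 => ?_⟩
  obtain ⟨F, hF⟩ := h.exists_finset_eq_zero h𝔟 h0 hu
  have hsum : idealSum ψ 𝔟 Φ s u = ∑ r, (h.residue r : ℂ) *
      latticeSum (idealLatticeBasis J) Φ s u (mixedEmbedding K (a r)) := by
    have hterm : ∀ r v, (ψ (Ideal.span {(e (r, v) : 𝓞 K)}) : ℂ) *
        Φ (s, u • mixedEmbedding K (e (r, v) : 𝓞 K)) =
          h.residue r * Φ (s, u • (mixedEmbedding K (a r) + v)) := fun r v => by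
      rw [← h.residue_mk, (he r v).1, (he r v).2]
    have hsummable : Summable fun x : (𝔟 : Ideal (𝓞 K)) =>
        (ψ (Ideal.span {(x : 𝓞 K)}) : ℂ) * Φ (s, u • mixedEmbedding K (x : 𝓞 K)) :=
      summable_of_ne_finset_zero (s := F) fun x hx => by rw [hF s x hx, mul_zero]
    have hs' := (e.summable_iff.2 hsummable).tsum_prod
    simp only [Function.comp_apply] at hs'
    rw [idealSum, ← e.tsum_eq, hs', tsum_fintype]
    refine Finset.sum_congr rfl fun r _ => ?_
    simp only [latticeSum, hterm]
    rw [tsum_mul_left]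
  have hc := fun r => hC s hs u hu hu1 (mixedEmbedding K (a r))
  rw [volume_real_fundamentalDomain_idealLatticeBasis, mixedEmbedding.finrank, hJ, map_mul,
    Nat.cast_mul] at hc
  set M : ℂ := ((u ^ finrank ℚ K * (Ideal.absNorm (𝔟 : Ideal (𝓞 K)) * Ideal.absNorm 𝔪 *
          volume.real (ZSpan.fundamentalDomain (latticeBasis K))))⁻¹ : ℝ) *
            ∫ x, Φ (s, x)
  rw [hsum, Int.cast_sum, Finset.sum_mul, ← Finset.sum_sub_distrib]
  refine (norm_sum_le _ _).trans ?_
  rw [mul_assoc, ← nsmul_eq_mul]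
  refine Finset.sum_le_card_nsmul _ _ _ fun r _ => ?_
  rw [← mul_sub, norm_mul]
  refine (mul_le_mul ?_ (hc r) (norm_nonneg _) zero_le_one).trans_eq (one_mul _)
  rw [Complex.norm_intCast]
  exact_mod_cast h.abs_le_one _

end IsQuadraticHeckeCharacter

end IdealLattice

section ClassSum

open scoped Classical nonZeroDivisors

open NumberField.mixedEmbedding MeasureTheory

variable {K : Type*} [Field K] [NumberField K]

/-- The factor by which an ideal has to be scaled to have covolume independent of the ideal. -/
noncomputable def normScale (I : Ideal (𝓞 K)) : ℝ :=
  (Ideal.absNorm I : ℝ) ^ (-(finrank ℚ K : ℝ)⁻¹)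

theorem one_le_absNorm {I : Ideal (𝓞 K)} (hI : I ≠ ⊥) : (1 : ℝ) ≤ Ideal.absNorm I := by
  exact_mod_cast Nat.one_le_iff_ne_zero.2 (Ideal.absNorm_eq_zero_iff.not.2 hI)

theorem normScale_pos {I : Ideal (𝓞 K)} (hI : I ≠ ⊥) : 0 < normScale I :=
  Real.rpow_pos_of_pos (zero_lt_one.trans_le (one_le_absNorm hI)) _

theorem normScale_le_one {I : Ideal (𝓞 K)} (hI : I ≠ ⊥) : normScale I ≤ 1 :=
  Real.rpow_le_one_of_one_le_of_nonpos (one_le_absNorm hI) (by simp)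

theorem normScale_pow_mul_absNorm {I : Ideal (𝓞 K)} (hI : I ≠ ⊥) :
    normScale I ^ finrank ℚ K * Ideal.absNorm I = 1 := by
  have h0 : (0 : ℝ) < Ideal.absNorm I := zero_lt_one.trans_le (one_le_absNorm hI)
  have hn : (finrank ℚ K : ℝ) ≠ 0 := Nat.cast_ne_zero.2 finrank_pos.ne'
  rw [normScale, ← Real.rpow_natCast, ← Real.rpow_mul h0.le, neg_mul, inv_mul_cancel₀ hn,
    Real.rpow_neg_one, inv_mul_cancel₀ h0.ne']

/-- The sum of the test function over all ideal classes at scale `exp (-j)`. -/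
noncomputable def classSum (ψ : Ideal (𝓞 K) → ℤ) (𝔟 : ClassGroup (𝓞 K) → (Ideal (𝓞 K))⁰)
    (s : ℂ) (j : ℕ) : ℂ :=
  ∑ k, (ψ (𝔟 k) : ℂ) * idealSum ψ (𝔟 k) testFun s (Real.exp (-j) * normScale (𝔟 k : Ideal (𝓞 K)))

namespace IsQuadraticHeckeCharacter

variable {𝔪 : Ideal (𝓞 K)} {ψ : Ideal (𝓞 K) → ℤ} {𝔟 : ClassGroup (𝓞 K) → (Ideal (𝓞 K))⁰}

theorem differentiable_classSum (h : IsQuadraticHeckeCharacter 𝔪 ψ)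
    (h𝔟 : ∀ k, IsCoprime (𝔟 k : Ideal (𝓞 K)) 𝔪) (j : ℕ) :
    Differentiable ℂ fun s => classSum ψ 𝔟 s j := by
  unfold classSum
  refine Differentiable.fun_sum fun k _ => Differentiable.const_mul ?_ _
  obtain ⟨R, hR⟩ := exists_testFun_eq_zero K
  obtain ⟨F, hF⟩ := h.exists_finset_eq_zero (h𝔟 k) hR (mul_pos (Real.exp_pos (-j))
    (normScale_pos (nonZeroDivisors.coe_ne_zero (𝔟 k))))
  have hsum : (fun s => idealSum ψ (𝔟 k) testFun s
      (Real.exp (-j) * normScale (𝔟 k : Ideal (𝓞 K)))) = fun s =>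
      ∑ x ∈ F, (ψ (Ideal.span {(x : 𝓞 K)}) : ℂ) * testFun (s,
        (Real.exp (-j) * normScale (𝔟 k : Ideal (𝓞 K))) • mixedEmbedding K (x : 𝓞 K)) :=
    funext fun s => tsum_eq_sum fun x hx => by rw [hF s x hx, mul_zero]
  rw [hsum]
  exact Differentiable.fun_sum fun x _ => (differentiable_testFun _).const_mul _

theorem exists_norm_classSum_le (h : IsQuadraticHeckeCharacter 𝔪 ψ)
    (h𝔟 : ∀ k, IsCoprime (𝔟 k : Ideal (𝓞 K)) 𝔪) (h𝔟' : ∀ k, ClassGroup.mk0 (𝔟 k) = k)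
    {A : Ideal (𝓞 K)} (hA : IsCoprime A 𝔪) (hA' : ψ A ≠ 1) (S : ℝ) (N : ℕ) :
    ∃ C : ℝ, 0 ≤ C ∧ ∀ s, ‖s‖ ≤ S → ∀ j, ‖classSum ψ 𝔟 s j‖ ≤ C * Real.exp (-j) ^ N := by
  have := Ideal.finiteQuotientOfFreeOfNeBot 𝔪 h.ne_bot
  have := Fintype.ofFinite (𝓞 K ⧸ 𝔪)
  obtain ⟨R, hR⟩ := exists_testFun_eq_zero K
  choose C hC0 hC using fun k => h.exists_norm_idealSum_sub_le (h𝔟 k) (contDiff_testFun K) hR S N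
  refine ⟨∑ k, C k, Finset.sum_nonneg fun k _ => hC0 k, fun s hs j => ?_⟩
  set W : ℂ := ((∑ r, h.residue r : ℤ) : ℂ) with hW
  set M : ℂ := (((Real.exp (-j) ^ finrank ℚ K * (Ideal.absNorm 𝔪 *
    volume.real (ZSpan.fundamentalDomain (latticeBasis K))))⁻¹ : ℝ) : ℂ) *
      ∫ x : mixedSpace K, testFun (s, x) with hM
  have hk : ∀ k, ‖idealSum ψ (𝔟 k) testFun s (Real.exp (-j) * normScale (𝔟 k : Ideal (𝓞 K))) -
      W * M‖ ≤ C k * Real.exp (-j) ^ N := fun k => by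
    have hb : (𝔟 k : Ideal (𝓞 K)) ≠ ⊥ := nonZeroDivisors.coe_ne_zero (𝔟 k)
    have hpos := mul_pos (Real.exp_pos (-j)) (normScale_pos hb)
    have hle : Real.exp (-j) * normScale (𝔟 k : Ideal (𝓞 K)) ≤ Real.exp (-j) :=
      mul_le_of_le_one_right (Real.exp_pos _).le (normScale_le_one hb)
    have h1 := hC k s hs _ hpos (hle.trans (Real.exp_le_one_iff.2 (by simp)))
    have h2 : (Real.exp (-j) * normScale (𝔟 k : Ideal (𝓞 K))) ^ finrank ℚ K *
        (Ideal.absNorm (𝔟 k : Ideal (𝓞 K)) * Ideal.absNorm 𝔪 *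
          volume.real (ZSpan.fundamentalDomain (latticeBasis K))) =
        Real.exp (-j) ^ finrank ℚ K * (Ideal.absNorm 𝔪 *
          volume.real (ZSpan.fundamentalDomain (latticeBasis K))) := by
      rw [mul_pow]
      linear_combination (Real.exp (-j) ^ finrank ℚ K * (Ideal.absNorm 𝔪 *
          volume.real (ZSpan.fundamentalDomain (latticeBasis K)))) * normScale_pow_mul_absNorm hb
    rw [h2] at h1
    refine h1.trans (mul_le_mul_of_nonneg_left (pow_le_pow_left₀ hpos.le hle N) (hC0 k))
  have hzero : ∑ k, (ψ (𝔟 k) : ℂ) * (W * M) = 0 := by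
    rw [← Finset.sum_mul, ← mul_assoc, hW, ← Int.cast_sum, ← Int.cast_mul,
      h.sum_mul_sum_residue_eq_zero h𝔟 h𝔟' hA hA', Int.cast_zero, zero_mul]
  rw [← sub_zero (classSum ψ 𝔟 s j), ← hzero, classSum, ← Finset.sum_sub_distrib, Finset.sum_mul]
  refine norm_sum_le_of_le _ fun k _ => ?_
  rw [← mul_sub, norm_mul]
  refine (mul_le_mul ?_ (hk k) (norm_nonneg _) zero_le_one).trans_eq (one_mul _)
  rw [Complex.norm_intCast]
  exact_mod_cast h.abs_le_one _

theorem differentiable_tsum_classSum (h : IsQuadraticHeckeCharacter 𝔪 ψ)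
    (h𝔟 : ∀ k, IsCoprime (𝔟 k : Ideal (𝓞 K)) 𝔪) (h𝔟' : ∀ k, ClassGroup.mk0 (𝔟 k) = k)
    {A : Ideal (𝓞 K)} (hA : IsCoprime A 𝔪) (hA' : ψ A ≠ 1) :
    Differentiable ℂ fun s => ∑' j : ℕ,
      Complex.exp (-(j * finrank ℚ K) * s) * classSum ψ 𝔟 s j := by
  intro s₀
  set S : ℝ := ‖s₀‖ + 1
  set N : ℕ := ⌈finrank ℚ K * S⌉₊ + 1
  obtain ⟨C, hC0, hC⟩ := h.exists_norm_classSum_le h𝔟 h𝔟' hA hA' S N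
  have hsummable : Summable fun j : ℕ => C * Real.exp (-1) ^ j :=
    (summable_geometric_of_lt_one (Real.exp_pos _).le (Real.exp_lt_one_iff.2 (by norm_num))).mul_left C
  refine (Complex.differentiableOn_tsum_of_summable_norm hsummable (U := Metric.ball 0 S)
    (fun j => (Differentiable.fun_mul (by fun_prop)
      (h.differentiable_classSum h𝔟 j)).differentiableOn) Metric.isOpen_ball
    fun j s hs => ?_).differentiableAt (Metric.isOpen_ball.mem_nhds (by simp [S]))
  have hs' : ‖s‖ ≤ S := by simpa using (Metric.mem_ball.1 hs).le
  rw [norm_mul]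
  calc _ ≤ Real.exp (j * (finrank ℚ K * S)) * (C * Real.exp (-j) ^ N) := by
        refine mul_le_mul ?_ (hC s hs' j) (norm_nonneg _) (Real.exp_pos _).le
        rw [Complex.norm_exp, Real.exp_le_exp]
        refine (Complex.re_le_norm _).trans ?_
        rw [norm_mul, norm_neg, norm_mul, Complex.norm_natCast, Complex.norm_natCast, mul_assoc]
        gcongr
    _ = C * Real.exp (j * (finrank ℚ K * S) - N * j) := by
        rw [← Real.exp_nat_mul, mul_left_comm, ← Real.exp_add]
        ring_nf
    _ ≤ C * Real.exp (-j) := by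
        gcongr
        have h1 : finrank ℚ K * S + 1 ≤ N := by
          simp only [N]
          push_cast
          gcongr
          exact Nat.le_ceil _
        nlinarith [Nat.cast_nonneg (α := ℝ) j]
    _ = C * Real.exp (-1) ^ j := by rw [← Real.exp_nat_mul]; simp

end IsQuadraticHeckeCharacter

end ClassSum

section AbsoluteConvergence

open Filter Topology

open scoped nonZeroDivisors

variable (K : Type*) [Field K] [NumberField K]

theorem sum_card_absNorm_isBigO :
    (fun n : ℕ => ∑ k ∈ Finset.Icc 1 n,
      ‖((Nat.card {I : Ideal (𝓞 K) // Ideal.absNorm I = k} : ℕ) : ℂ)‖) =O[atTop]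
        fun n : ℕ => (n : ℝ) ^ (1 : ℝ) := by
  have h1 := ((Ideal.tendsto_norm_le_div_atTop₀ K).comp
    tendsto_natCast_atTop_atTop).isBigO_one ℝ
  have h2 := h1.mul (Asymptotics.isBigO_refl (fun n : ℕ => (n : ℝ)) atTop)
  refine h2.congr' ?_ (by simp)
  filter_upwards [eventually_ne_atTop 0] with n hn
  have hn' : (n : ℝ) ≠ 0 := Nat.cast_ne_zero.2 hn
  simp only [Function.comp_apply, Nat.cast_le, Complex.norm_natCast, ← Nat.cast_sum]
  rw [div_mul_cancel₀ _ hn', Nat.cast_inj, ← add_left_inj 1,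
    ← Ideal.card_norm_le_eq_card_norm_le_add_one,
    show Finset.Icc 1 n = Finset.Ioc 0 n from Finset.Icc_succ_left_eq_Ioc _ _,
    show 1 = Nat.card {I : Ideal (𝓞 K) // Ideal.absNorm I = 0} by
      simp [Ideal.absNorm_eq_zero_iff],
    Finset.sum_Ioc_add_eq_sum_Icc n.zero_le,
    ← Finset.card_preimage_eq_sum_card_image_eq fun k _ => Ideal.finite_setOfPred_absNorm_eq k]
  simp [Set.coe_eq_subtype]

theorem summable_absNorm_rpow {σ : ℝ} (hσ : 1 < σ) :
    Summable fun I : Ideal (𝓞 K) => (Ideal.absNorm I : ℝ) ^ (-σ) := by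
  have h1 := (LSeriesSummable_of_sum_norm_bigO (s := σ) (sum_card_absNorm_isBigO K) zero_le_one
    (by simpa using hσ)).norm
  rw [← (Equiv.sigmaFiberEquiv fun I : Ideal (𝓞 K) => Ideal.absNorm I).summable_iff]
  have hfin : ∀ n : ℕ, Finite {I : Ideal (𝓞 K) // Ideal.absNorm I = n} := fun n =>
    (Ideal.finite_setOfPred_absNorm_eq n).to_subtype
  refine (summable_sigma_of_nonneg fun _ => Real.rpow_nonneg (Nat.cast_nonneg _) _).2
    ⟨fun n => Summable.of_finite, h1.congr fun n => ?_⟩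
  have := Fintype.ofFinite {I : Ideal (𝓞 K) // Ideal.absNorm I = n}
  have hterm : ∀ I : {I : Ideal (𝓞 K) // Ideal.absNorm I = n},
      (Ideal.absNorm (Equiv.sigmaFiberEquiv (fun I : Ideal (𝓞 K) => Ideal.absNorm I) ⟨n, I⟩) : ℝ)
        ^ (-σ) = (n : ℝ) ^ (-σ) :=
    fun I => by simp [I.2]
  rw [tsum_congr hterm, tsum_fintype, Finset.sum_const, Finset.card_univ, ← Nat.card_eq_fintype_card, nsmul_eq_mul]
  rcases eq_or_ne n 0 with rfl | hn
  · simp [Real.zero_rpow (by linarith : -σ ≠ 0)]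
  · rw [LSeries.norm_term_eq, if_neg hn, Complex.norm_natCast, Complex.ofReal_re,
      Real.rpow_neg (Nat.cast_nonneg _), div_eq_mul_inv]

theorem summable_norm_absNorm_cpow {s : ℂ} (hs : 1 < s.re) {ψ : Ideal (𝓞 K) → ℤ}
    (hψ : ∀ I, |ψ I| ≤ 1) :
    Summable fun I : {I : Ideal (𝓞 K) // I ≠ ⊥} =>
      ‖(ψ I.1 : ℂ) * (Ideal.absNorm I.1 : ℂ) ^ (-s)‖ := by
  refine Summable.of_nonneg_of_le (fun _ => norm_nonneg _) (fun I => ?_)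
    ((summable_absNorm_rpow K hs).comp_injective Subtype.val_injective)
  have hI : 0 < Ideal.absNorm I.1 := Nat.pos_of_ne_zero (Ideal.absNorm_eq_zero_iff.not.2 I.2)
  rw [norm_mul, Complex.norm_intCast, Complex.norm_natCast_cpow_of_pos hI, Complex.neg_re]
  refine mul_le_of_le_one_left (Real.rpow_nonneg (Nat.cast_nonneg _) _) ?_
  exact_mod_cast hψ I.1

end AbsoluteConvergence

section ClassRepresentatives

open scoped nonZeroDivisors

variable {R : Type*} [CommRing R] [IsDedekindDomain R]
  {𝔟 : ClassGroup R → (Ideal R)⁰}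

theorem exists_class_mul_eq_span (h𝔟' : ∀ k, ClassGroup.mk0 (𝔟 k) = k)
    (I : {I : Ideal R // I ≠ ⊥}) : ∃ k, ∃ x : R, x ≠ 0 ∧ 𝔟 k * I.1 = Ideal.span {x} := by
  obtain ⟨c, hc⟩ : ∃ c : (Ideal R)⁰, (c : Ideal R) = I.1 :=
    ⟨⟨I.1, mem_nonZeroDivisors_iff_ne_zero.2 I.2⟩, rfl⟩
  have h := (ClassGroup.mk0_eq_mk0_inv_iff (I := 𝔟 (ClassGroup.mk0 c)⁻¹) (J := c)).1 (h𝔟' _)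
  rw [hc] at h
  exact ⟨_, h⟩

theorem class_eq_of_mul_eq_span (h𝔟' : ∀ k, ClassGroup.mk0 (𝔟 k) = k) {I : Ideal R} (hI : I ≠ ⊥)
    {k k' : ClassGroup R} {x x' : R} (hx : x ≠ 0) (hx' : x' ≠ 0) (h : 𝔟 k * I = Ideal.span {x})
    (h' : 𝔟 k' * I = Ideal.span {x'}) : k = k' := by
  obtain ⟨c, rfl⟩ : ∃ c : (Ideal R)⁰, (c : Ideal R) = I :=
    ⟨⟨I, mem_nonZeroDivisors_iff_ne_zero.2 hI⟩, rfl⟩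
  rw [← h𝔟' k, ← h𝔟' k', ClassGroup.mk0_eq_mk0_inv_iff.2 ⟨x, hx, h⟩,
    ClassGroup.mk0_eq_mk0_inv_iff.2 ⟨x', hx', h'⟩]

/-- Multiplying by a fixed ideal in the inverse class turns the nonzero ideals, up to units, into
the nonzero elements of these ideals. -/
theorem exists_unfolding (h𝔟' : ∀ k, ClassGroup.mk0 (𝔟 k) = k) :
    ∃ x₀ : {I : Ideal R // I ≠ ⊥} → R,
      ∃ f : {I : Ideal R // I ≠ ⊥} × Rˣ → Σ k, (𝔟 k : Ideal R),
        Function.Injective f ∧ (∀ p ∉ Set.range f, (p.2 : R) = 0) ∧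
          ∀ I u, x₀ I ≠ 0 ∧ ((f (I, u)).2 : R) = u * x₀ I ∧
            Ideal.span {((f (I, u)).2 : R)} = 𝔟 (f (I, u)).1 * I.1 := by
  choose k x₀ hx0 hx₀ using exists_class_mul_eq_span h𝔟'
  have hspan : ∀ I (u : Rˣ), Ideal.span {(u * x₀ I : R)} = 𝔟 (k I) * I.1 := fun I u => by
    rw [hx₀, Ideal.span_singleton_mul_left_unit u.isUnit]
  have hmem : ∀ I (u : Rˣ), (u * x₀ I : R) ∈ (𝔟 (k I) : Ideal R) := fun I u => by
    rw [← Ideal.span_singleton_le_iff_mem, ← Ideal.dvd_iff_le, hspan]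
    exact dvd_mul_right _ _
  let f : {I : Ideal R // I ≠ ⊥} × Rˣ → Σ k, (𝔟 k : Ideal R) :=
    fun p => ⟨k p.1, p.2 * x₀ p.1, hmem p.1 p.2⟩
  refine ⟨x₀, f, ?_, ?_, fun I u => ⟨hx0 I, rfl, hspan I u⟩⟩
  · rintro ⟨I, u⟩ ⟨I', u'⟩ hII'
    have h1 : k I = k I' := congrArg Sigma.fst hII'
    have h2 : (u * x₀ I : R) = u' * x₀ I' :=
      congrArg (fun p : Σ k, (𝔟 k : Ideal R) => (p.2 : R)) hII'
    have h3 := hspan I u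
    rw [h2, hspan I' u', h1] at h3
    obtain rfl : I' = I :=
      Subtype.ext (mul_left_cancel₀ (nonZeroDivisors.coe_ne_zero (𝔟 (k I'))) h3)
    rw [Units.ext (mul_right_cancel₀ (hx0 I') h2)]
  · rintro ⟨l, x, hxl⟩ hp
    by_contra hx
    obtain ⟨I, hI⟩ : (𝔟 l : Ideal R) ∣ Ideal.span {x} :=
      Ideal.dvd_iff_le.2 ((Ideal.span_singleton_le_iff_mem _).2 hxl)
    have hI0 : I ≠ ⊥ := by
      rintro rfl
      exact hx (by simpa using hI)
    obtain rfl : l = k ⟨I, hI0⟩ :=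
      class_eq_of_mul_eq_span h𝔟' hI0 hx (hx0 _) hI.symm (hx₀ ⟨I, hI0⟩)
    obtain ⟨u, hu⟩ := Ideal.span_singleton_eq_span_singleton.1 ((hx₀ ⟨I, hI0⟩).symm.trans hI.symm)
    refine hp ⟨(⟨I, hI0⟩, u), ?_⟩
    have hu' : u * x₀ ⟨I, hI0⟩ = x := by rw [← hu, mul_comm]
    subst hu'
    rfl

end ClassRepresentatives

theorem hasSum_of_hasSum_prod {P U : Type*} {a : P → ℂ} (ha : Summable fun I => ‖a I‖)
    {w : P → U → ℝ} {T : ℝ} (hw0 : ∀ I u, 0 ≤ w I u) (hw : ∀ I, HasSum (w I) T)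
    {c : P → ℕ → ℝ} (hc0 : ∀ I j, 0 ≤ c I j) (hc : ∀ I, HasSum (c I) 1) {H : ℕ → ℂ}
    (hH : ∀ j, HasSum (fun p : P × U => a p.1 * ((w p.1 p.2 * c p.1 j : ℝ) : ℂ)) (H j)) :
    HasSum H ((∑' I, a I) * T) := by
  have h1 : ∀ I, HasSum (fun q : U × ℕ => w I q.1 * c I q.2) T := fun I => by
    have := (hw I).mul (hc I) ((hw I).summable.mul_of_nonneg (hc I).summable (hw0 I) (hc0 I))
    rwa [mul_one] at this
  let f : P × (U × ℕ) → ℂ := fun p => a p.1 * ((w p.1 p.2.1 * c p.1 p.2.2 : ℝ) : ℂ)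
  have hnorm : ∀ p, ‖f p‖ = ‖a p.1‖ * (w p.1 p.2.1 * c p.1 p.2.2) := fun p => by
    rw [norm_mul, Complex.norm_real, Real.norm_of_nonneg (mul_nonneg (hw0 _ _) (hc0 _ _))]
  have hf : Summable f := by
    refine Summable.of_norm ((summable_prod_of_nonneg fun _ => norm_nonneg _).2 ⟨fun I => ?_, ?_⟩)
    · simp only [hnorm]
      exact (h1 I).summable.mul_left _
    · simp only [hnorm, fun I => ((h1 I).mul_left ‖a I‖).tsum_eq]
      exact ha.mul_right T
  have h2 : HasSum f ((∑' I, a I) * T) := by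
    have h3 := hf.hasSum.prod_fiberwise fun I =>
      ((Complex.hasSum_ofReal.2 (h1 I)).mul_left (a I))
    rw [(ha.of_norm.hasSum.mul_right (T : ℂ)).unique h3]
    exact hf.hasSum
  let e : ℕ × (P × U) ≃ P × (U × ℕ) := (Equiv.prodComm _ _).trans (Equiv.prodAssoc _ _ _)
  exact ((e.hasSum_iff).2 h2).prod_fiberwise hH

theorem hasSum_sigma_mul_tsum {κ : Type*} [Fintype κ] {β : κ → Type*} (a : κ → ℂ)
    {g : ∀ k, β k → ℂ} (F : ∀ k, Finset (β k)) (hF : ∀ k, ∀ x ∉ F k, g k x = 0) :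
    HasSum (fun p : Σ k, β k => a p.1 * g p.1 p.2) (∑ k, a k * ∑' x, g k x) := by
  refine HasSum.sigma_of_hasSum (hasSum_fintype _)
    (fun k => (summable_of_ne_finset_zero (hF k)).hasSum.mul_left _)
    (summable_of_ne_finset_zero (s := Finset.univ.sigma F) fun p hp => ?_)
  rw [hF p.1 p.2 (by simpa using hp), mul_zero]

section Unfolding

open scoped Classical nonZeroDivisors

open NumberField.mixedEmbedding NumberField.mixedEmbedding.fundamentalCone NumberField.Units

variable {K : Type*} [Field K] [NumberField K]

theorem norm_mixedEmbedding_eq_absNorm_span (x : 𝓞 K) :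
    mixedEmbedding.norm (mixedEmbedding K x) = Ideal.absNorm (Ideal.span {x}) := by
  rw [mixedEmbedding.norm_eq_norm, Ideal.absNorm_span_singleton, Nat.cast_natAbs,
    ← Algebra.coe_norm_int]
  simp

namespace IsQuadraticHeckeCharacter

variable {𝔪 : Ideal (𝓞 K)} {ψ : Ideal (𝓞 K) → ℤ} {𝔟 : ClassGroup (𝓞 K) → (Ideal (𝓞 K))⁰}

theorem hasSum_sigma_classSum (h : IsQuadraticHeckeCharacter 𝔪 ψ)
    (h𝔟 : ∀ k, IsCoprime (𝔟 k : Ideal (𝓞 K)) 𝔪) (s : ℂ) (j : ℕ) :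
    HasSum (fun p : Σ k, (𝔟 k : Ideal (𝓞 K)) => (ψ (𝔟 p.1) : ℂ) *
      ((ψ (Ideal.span {(p.2 : 𝓞 K)}) : ℂ) * testFun (s,
        (Real.exp (-j) * normScale (𝔟 p.1 : Ideal (𝓞 K))) • mixedEmbedding K (p.2 : 𝓞 K))))
      (classSum ψ 𝔟 s j) := by
  obtain ⟨R, hR⟩ := exists_testFun_eq_zero K
  have hu : ∀ k, 0 < Real.exp (-j) * normScale (𝔟 k : Ideal (𝓞 K)) := fun k =>
    mul_pos (Real.exp_pos _) (normScale_pos (nonZeroDivisors.coe_ne_zero (𝔟 k)))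
  choose F hF using fun k => h.exists_finset_eq_zero (h𝔟 k) hR (hu k)
  have hg : ∀ k, ∀ x ∉ F k, (ψ (Ideal.span {(x : 𝓞 K)}) : ℂ) * testFun (s,
      (Real.exp (-j) * normScale (𝔟 k : Ideal (𝓞 K))) • mixedEmbedding K (x : 𝓞 K)) = 0 :=
    fun k x hx => by rw [hF k s x hx, mul_zero]
  have h2 := hasSum_sigma_mul_tsum (fun k => (ψ (𝔟 k) : ℂ)) F hg
  unfold classSum idealSum
  exact h2

theorem hasSum_exp_mul_classSum (h : IsQuadraticHeckeCharacter 𝔪 ψ)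
    (h𝔟 : ∀ k, IsCoprime (𝔟 k : Ideal (𝓞 K)) 𝔪) (h𝔟' : ∀ k, ClassGroup.mk0 (𝔟 k) = k)
    {s : ℂ} (hs : 1 < s.re) :
    HasSum (fun j : ℕ => Complex.exp (-(j * finrank ℚ K) * s) * classSum ψ 𝔟 s j)
      ((∑' I : {I : Ideal (𝓞 K) // I ≠ ⊥}, (ψ I.1 : ℂ) * (Ideal.absNorm I.1 : ℂ) ^ (-s)) *
        (torsionOrder K : ℝ)) := by
  obtain ⟨x₀, f, hf, hf0, hfx⟩ := exists_unfolding h𝔟'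
  have hnorm0 : ∀ x : 𝓞 K, x ≠ 0 → mixedEmbedding.norm (mixedEmbedding K x) ≠ 0 := fun x hx => by
    rw [norm_mixedEmbedding_eq_absNorm_span, Nat.cast_ne_zero, Ne, Ideal.absNorm_eq_zero_iff]
    simpa using hx
  refine hasSum_of_hasSum_prod (summable_norm_absNorm_cpow K hs h.abs_le_one)
    (w := fun I u => unitWeight (u • mixedEmbedding K (x₀ I)))
    (c := fun I j => smoothStepDiff (Real.log (Ideal.absNorm I.1) / finrank ℚ K - j))
    (fun _ _ => unitWeight_nonneg _)
    (fun I => hasSum_unitWeight_unit_smul (hnorm0 _ (hfx I 1).1))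
    (fun _ _ => smoothStepDiff_nonneg _)
    (fun I => hasSum_smoothStepDiff_sub_natCast
      (div_nonneg (Real.log_nonneg (one_le_absNorm I.2)) (Nat.cast_nonneg _))) fun j => ?_
  have h1 := (hf.hasSum_iff fun p hp => ?_).2 ((h.hasSum_sigma_classSum h𝔟 s j).mul_left
    (Complex.exp (-(j * finrank ℚ K) * s)))
  · refine h1.congr_fun fun p => ?_
    obtain ⟨I, u⟩ := p
    obtain ⟨-, hx, hspan⟩ := hfx I u
    have hx0 : ((f (I, u)).2 : 𝓞 K) ≠ 0 := by
      rw [hx]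
      exact mul_ne_zero u.ne_zero (hfx I u).1
    simp only [Function.comp_apply]
    generalize (f (I, u)).1 = k, ((f (I, u)).2 : 𝓞 K) = x at *
    have hk : (𝔟 k : Ideal (𝓞 K)) ≠ ⊥ := nonZeroDivisors.coe_ne_zero (𝔟 k)
    have hy : mixedEmbedding.norm (normScale (𝔟 k : Ideal (𝓞 K)) • mixedEmbedding K x) =
        Ideal.absNorm I.1 := by
      rw [mixedEmbedding.norm_smul, abs_of_pos (normScale_pos hk),
        norm_mixedEmbedding_eq_absNorm_span, hspan, map_mul, Nat.cast_mul, ← mul_assoc,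
        normScale_pow_mul_absNorm hk, one_mul]
    have hy0 : mixedEmbedding.norm (normScale (𝔟 k : Ideal (𝓞 K)) • mixedEmbedding K x) ≠ 0 := by
      rw [hy]
      exact (zero_lt_one.trans_le (one_le_absNorm I.2)).ne'
    have hT := testFun_smul s hy0 j
    rw [hy, ← mul_smul, unitWeight_smul (hnorm0 x hx0) (normScale_pos hk).ne'] at hT
    have hψ : (ψ (𝔟 k) : ℂ) * ψ (Ideal.span {x}) = ψ I.1 := by
      rw [hspan, h.mul, Int.cast_mul, ← mul_assoc, ← Int.cast_mul, h.mul_self (h𝔟 k), Int.cast_one,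
        one_mul]
    rw [unit_smul_eq_iff_mul_eq.2 hx.symm, ← hψ]
    push_cast at hT ⊢
    linear_combination -(ψ (𝔟 k) : ℂ) * ψ (Ideal.span {x}) * hT
  · rw [hf0 p hp]
    simp [testFun_of_norm_eq_zero]

end IsQuadraticHeckeCharacter

end Unfolding

end

/-- If `ψ` is a nontrivial Hecke character of trivial infinite type modulo `𝔪`
(multiplicative, valued in `{0,±1}`, vanishing on ideals not coprime to `𝔪`, with
`ψ((a)) = 1` whenever `a ≡ 1 (mod 𝔪)`), then its `L`-series, absolutely convergent
for `Re(s) > 1`, extends to an entire function. -/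
theorem hecke_L_entire_of_nontrivial
    (K : Type*) [Field K] [NumberField K]
    (𝔪 : Ideal (𝓞 K)) (h𝔪 : 𝔪 ≠ ⊥)
    (ψ : Ideal (𝓞 K) → ℤ)
    (hval : ∀ 𝒜, ψ 𝒜 = 0 ∨ ψ 𝒜 = 1 ∨ ψ 𝒜 = -1)
    (hmul : ∀ 𝒜 ℬ : Ideal (𝓞 K), ψ (𝒜 * ℬ) = ψ 𝒜 * ψ ℬ)
    (hvanish : ∀ 𝒜 : Ideal (𝓞 K), ¬ IsCoprime 𝒜 𝔪 → ψ 𝒜 = 0)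
    (hprincipal : ∀ a : 𝓞 K, a - 1 ∈ 𝔪 → ψ (Ideal.span {a}) = 1)
    (hnontrivial : ∃ 𝒜 : Ideal (𝓞 K), 𝒜 ≠ ⊥ ∧ IsCoprime 𝒜 𝔪 ∧ ψ 𝒜 ≠ 1) :
    (∀ s : ℂ, 1 < s.re →
      Summable fun 𝒜 : {I : Ideal (𝓞 K) // I ≠ ⊥} =>
        ‖(ψ 𝒜.1 : ℂ) * (Ideal.absNorm 𝒜.1 : ℂ) ^ (-s)‖) ∧
    ∃ F : ℂ → ℂ, Differentiable ℂ F ∧ ∀ s : ℂ, 1 < s.re →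
      F s = ∑' 𝒜 : {I : Ideal (𝓞 K) // I ≠ ⊥},
        (ψ 𝒜.1 : ℂ) * (Ideal.absNorm 𝒜.1 : ℂ) ^ (-s) := by
  by_cases h𝔪' : 𝔪 = ⊤
  · subst h𝔪'
    obtain ⟨A, -, -, hA⟩ := hnontrivial
    have h0 : ψ ⊥ = 1 := by simpa using hprincipal 0 (by simp)
    have hA' := hmul ⊥ A
    rw [Ideal.bot_mul, h0, one_mul] at hA'
    exact absurd hA'.symm hA
  have h : IsQuadraticHeckeCharacter 𝔪 ψ := ⟨h𝔪, h𝔪', hval, hmul, hvanish, hprincipal⟩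
  refine ⟨fun s hs => summable_norm_absNorm_cpow K hs h.abs_le_one, ?_⟩
  choose 𝔟 h𝔟 h𝔟' using exists_isCoprime_mk0_eq h𝔪 h𝔪'
  obtain ⟨A, -, hA, hA'⟩ := hnontrivial
  refine ⟨_, (h.differentiable_tsum_classSum h𝔟 h𝔟' hA hA').const_mul
    ((Units.torsionOrder K : ℝ) : ℂ)⁻¹, fun s hs => ?_⟩
  rw [(h.hasSum_exp_mul_classSum h𝔟 h𝔟' hs).tsum_eq, mul_comm, mul_assoc, mul_inv_cancel₀, mul_one]
  exact_mod_cast Units.torsionOrder_ne_zero K
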